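/- Bernstein–von Mises theorem for the posterior predictive distribution (Theorem 7): let X̃ ∈ ℝ^{d×p} be given and let f^n_{X̃}(ỹ) = Σ_S π^n(S)·f^n_{X̃}(ỹ|S), where f^n_{X̃}(·|S) is the multivariate t distribution with 2a₀ + αn degrees of freedom, location X̃_Sβ̂_S, and scale matrix [(b₀ + (α/2)‖y − ŷ_S‖²)/(a₀ + αn/2)]·(I_d + (1/(α+γ))X̃_S(X̃_SᵀX̃_S)⁻¹X̃_Sᵀ). Assume s* = o(√n / log n) and E_{β*}[π^n(S*)] → 1. Then E_{β*}[H²(f^n_{X̃}, N_d(X̃_{S*}β̂_{S*}, σ₀²[I_d + (1/(α+γ))X̃_{S*}(X̃_{S*}ᵀX̃_{S*})⁻¹X̃_{S*}ᵀ]))] → 0 uniformly in β* as n → ∞; consequently, since d_TV ≤ H², the same convergence holds in total variation distance. -/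

import Mathlib

open MeasureTheory ProbabilityTheory Real Filter Matrix
open scoped ENNReal NNReal BigOperators Classical

noncomputable section

namespace EmpiricalBayes

/-- Submatrix of columns of `X` indexed by `S`. -/
def XS {n p : ℕ} (X : Matrix (Fin n) (Fin p) ℝ) (S : Finset (Fin p)) :
    Matrix (Fin n) {j // j ∈ S} ℝ := Matrix.of fun i j => X i j.1

/-- The Gram matrix `X_Sᵀ X_S`. -/
def gram {n p : ℕ} (X : Matrix (Fin n) (Fin p) ℝ) (S : Finset (Fin p)) :
    Matrix {j // j ∈ S} {j // j ∈ S} ℝ := (XS X S)ᵀ * XS X S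

/-- Least squares estimator `β̂_S = (X_SᵀX_S)⁻¹X_Sᵀ y`. -/
def betaHat {n p : ℕ} (X : Matrix (Fin n) (Fin p) ℝ) (S : Finset (Fin p))
    (y : Fin n → ℝ) : {j // j ∈ S} → ℝ := ((gram X S)⁻¹ * (XS X S)ᵀ).mulVec y

/-- Fitted values `ŷ_S = X_S β̂_S`. -/
def yHat {n p : ℕ} (X : Matrix (Fin n) (Fin p) ℝ) (S : Finset (Fin p))
    (y : Fin n → ℝ) : Fin n → ℝ := (XS X S).mulVec (betaHat X S y)

/-- Residual sum of squares `‖y - ŷ_S‖²`. -/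
def rss {n p : ℕ} (X : Matrix (Fin n) (Fin p) ℝ) (S : Finset (Fin p))
    (y : Fin n → ℝ) : ℝ := ∑ i, (y i - yHat X S y i) ^ 2

/-- Quadratic form `(β_S - β̂_S)ᵀ X_SᵀX_S (β_S - β̂_S)`. -/
def quadForm {n p : ℕ} (X : Matrix (Fin n) (Fin p) ℝ) (S : Finset (Fin p))
    (y : Fin n → ℝ) (b : {j // j ∈ S} → ℝ) : ℝ :=
  (b - betaHat X S y) ⬝ᵥ ((gram X S).mulVec (b - betaHat X S y))

/-- Prior weight `π(S) = binom(p,|S|)⁻¹ (c p^a)^{-|S|}` for `|S| ≤ R`, `0` otherwise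
(the normalizing constant of `f_n` is irrelevant, as it cancels in the posterior). -/
def priorWt (p R : ℕ) (a c : ℝ) (S : Finset (Fin p)) : ℝ :=
  if S.card ≤ R then ((p.choose S.card : ℝ))⁻¹ * (c * (p : ℝ) ^ a) ^ (-(S.card : ℝ)) else 0

/-- Exponent `nα/2 + s/2 + a₀` of the multivariate t kernel. -/
def tExp (n : ℕ) (α a₀ : ℝ) (s : ℕ) : ℝ := n * α / 2 + s / 2 + a₀

/-- The (unnormalized) density `D_S^n(β_S)` of the empirical Bayes posterior on model `S`. -/
def Ddens {n p : ℕ} (R : ℕ) (X : Matrix (Fin n) (Fin p) ℝ) (a₀ b₀ a c γ α : ℝ)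
    (y : Fin n → ℝ) (S : Finset (Fin p)) (b : {j // j ∈ S} → ℝ) : ℝ :=
  priorWt p R a c S * (2 * π) ^ (-(S.card : ℝ) / 2) * Real.Gamma (tExp n α a₀ S.card) *
    Real.sqrt ((γ • gram X S).det) *
    (b₀ + (α + γ) / 2 * quadForm X S y b + α / 2 * rss X S y) ^ (-(tExp n α a₀ S.card))

/-- Augment `β_S` with zeros outside `S`. -/
def augment {p : ℕ} (S : Finset (Fin p)) (b : {j // j ∈ S} → ℝ) : Fin p → ℝ :=
  fun j => if h : j ∈ S then b ⟨j, h⟩ else 0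

/-- The contribution `∫ D_S^n(dβ_S) δ_0(dβ_{S^c})` of model `S` to the (unnormalized)
empirical Bayes posterior. -/
def modelMeasure {n p : ℕ} (R : ℕ) (X : Matrix (Fin n) (Fin p) ℝ) (a₀ b₀ a c γ α : ℝ)
    (y : Fin n → ℝ) (S : Finset (Fin p)) : Measure (Fin p → ℝ) :=
  Measure.map (augment S)
    ((volume : Measure ({j // j ∈ S} → ℝ)).withDensity
      fun b => ENNReal.ofReal (Ddens R X a₀ b₀ a c γ α y S b))

/-- The unnormalized empirical Bayes posterior `Σ_S ∫ D_S^n(dβ_S) δ_0(dβ_{S^c})`. -/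
def postUnnorm {n p : ℕ} (R : ℕ) (X : Matrix (Fin n) (Fin p) ℝ) (a₀ b₀ a c γ α : ℝ)
    (y : Fin n → ℝ) : Measure (Fin p → ℝ) :=
  ∑ S : Finset (Fin p), modelMeasure R X a₀ b₀ a c γ α y S

/-- The empirical Bayes posterior `Π^n` on `ℝ^p`. -/
def post {n p : ℕ} (R : ℕ) (X : Matrix (Fin n) (Fin p) ℝ) (a₀ b₀ a c γ α : ℝ)
    (y : Fin n → ℝ) : Measure (Fin p → ℝ) :=
  (postUnnorm R X a₀ b₀ a c γ α y Set.univ)⁻¹ • postUnnorm R X a₀ b₀ a c γ α y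

/-- The Gaussian measure `N_n(m, v I_n)` on `ℝⁿ`. -/
def gaussVec (n : ℕ) (m : Fin n → ℝ) (v : ℝ) : Measure (Fin n → ℝ) :=
  Measure.pi fun i => gaussianReal (m i) v.toNNReal

/-- The sampling distribution of the data, `y ~ N_n(Xβ*, σ₀² I_n)`. -/
def dataDist {n p : ℕ} (X : Matrix (Fin n) (Fin p) ℝ) (βstar : Fin p → ℝ)
    (σ0sq : ℝ) : Measure (Fin n → ℝ) := gaussVec n (X.mulVec βstar) σ0sq

/-- Unnormalized marginal posterior model weight
`π(S)(γ/(α+γ))^{|S|/2}(b₀ + α‖y-ŷ_S‖²/2)^{-(a₀+αn/2)}`. -/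
def modelWt {n p : ℕ} (R : ℕ) (X : Matrix (Fin n) (Fin p) ℝ) (a₀ b₀ a c γ α : ℝ)
    (y : Fin n → ℝ) (S : Finset (Fin p)) : ℝ :=
  priorWt p R a c S * (γ / (α + γ)) ^ ((S.card : ℝ) / 2) *
    (b₀ + α / 2 * rss X S y) ^ (-(a₀ + α * n / 2))

/-- The marginal posterior probability `π^n(S)` of model `S`. -/
def postModel {n p : ℕ} (R : ℕ) (X : Matrix (Fin n) (Fin p) ℝ) (a₀ b₀ a c γ α : ℝ)
    (y : Fin n → ℝ) (S : Finset (Fin p)) : ℝ :=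
  modelWt R X a₀ b₀ a c γ α y S / ∑ S' : Finset (Fin p), modelWt R X a₀ b₀ a c γ α y S'

/-- The compatibility number `κ(s) = inf{‖Xβ‖₂/‖β‖₂ : 0 < |S_β| ≤ s}`. -/
def kappa {n p : ℕ} (X : Matrix (Fin n) (Fin p) ℝ) (s : ℝ) : ℝ :=
  sInf ((fun β : Fin p → ℝ =>
      Real.sqrt (∑ i, (X.mulVec β i) ^ 2) / Real.sqrt (∑ j, β j ^ 2)) ''
    {β | 0 < (Function.support β).ncard ∧ ((Function.support β).ncard : ℝ) ≤ s})

/-- Orthogonal projection `P_S = X_S(X_SᵀX_S)⁻¹X_Sᵀ` onto the column span of `X_S`. -/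
def projMat {n p : ℕ} (X : Matrix (Fin n) (Fin p) ℝ) (S : Finset (Fin p)) :
    Matrix (Fin n) (Fin n) ℝ := XS X S * (gram X S)⁻¹ * (XS X S)ᵀ

/-- Support of a coefficient vector as a `Finset`. -/
def suppFinset {p : ℕ} (β : Fin p → ℝ) : Finset (Fin p) :=
  Finset.univ.filter fun j => β j ≠ 0


/-- Squared Hellinger distance `H²(P,Q) = ∫ (√(dP/dν) − √(dQ/dν))² dν` with `ν = P + Q`. -/
def sqHellinger {E : Type*} [MeasurableSpace E] (P Q : Measure E) : ℝ :=
  ∫ x, (Real.sqrt ((P.rnDeriv (P + Q)) x).toReal -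
    Real.sqrt ((Q.rnDeriv (P + Q)) x).toReal) ^ 2 ∂(P + Q)

/-- Total variation distance `d_TV(P,Q) = sup_B |P(B) − Q(B)|`. -/
def tvDist {E : Type*} [MeasurableSpace E] (P Q : Measure E) : ℝ :=
  ⨆ A : {A : Set E // MeasurableSet A}, |(P A).toReal - (Q A).toReal|

/-- Density of the multivariate t distribution on `ℝ^d` with `ν` degrees of freedom,
location `m` and scale matrix `Σ`. -/
def tDensity (d : ℕ) (ν : ℝ) (m : Fin d → ℝ) (Sig : Matrix (Fin d) (Fin d) ℝ)
    (x : Fin d → ℝ) : ℝ :=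
  Real.Gamma ((ν + d) / 2) /
      (Real.Gamma (ν / 2) * ν ^ ((d : ℝ) / 2) * π ^ ((d : ℝ) / 2) * Real.sqrt Sig.det) *
    (1 + ν⁻¹ * ((x - m) ⬝ᵥ (Sig⁻¹.mulVec (x - m)))) ^ (-(ν + d) / 2)

/-- Density of the Gaussian distribution `N_d(m, Σ)` on `ℝ^d`. -/
def gaussDensity (d : ℕ) (m : Fin d → ℝ) (Sig : Matrix (Fin d) (Fin d) ℝ)
    (x : Fin d → ℝ) : ℝ :=
  (2 * π) ^ (-(d : ℝ) / 2) * (Real.sqrt Sig.det)⁻¹ *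
    Real.exp (-((x - m) ⬝ᵥ (Sig⁻¹.mulVec (x - m))) / 2)

/-- The scale matrix of the conditional posterior predictive t distribution given `S`:
`[(b₀+(α/2)‖y−ŷ_S‖²)/(a₀+αn/2)]·(I_d + (1/(α+γ))X̃_S(X̃_SᵀX̃_S)⁻¹X̃_Sᵀ)`. -/
def predScale {n p d : ℕ} (X : Matrix (Fin n) (Fin p) ℝ)
    (Xt : Matrix (Fin d) (Fin p) ℝ) (a₀ b₀ γ α : ℝ) (y : Fin n → ℝ)
    (S : Finset (Fin p)) : Matrix (Fin d) (Fin d) ℝ :=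
  ((b₀ + α / 2 * rss X S y) / (a₀ + α * n / 2)) •
    ((1 : Matrix (Fin d) (Fin d) ℝ) +
      (α + γ)⁻¹ • (XS Xt S * ((XS Xt S)ᵀ * XS Xt S)⁻¹ * (XS Xt S)ᵀ))

/-- The posterior predictive distribution `f^n_X̃ = Σ_S π^n(S) f^n_X̃(·|S)` on `ℝ^d`,
where `f^n_X̃(·|S)` is the multivariate t distribution with `2a₀+αn` degrees of freedom,
location `X̃_Sβ̂_S` and scale matrix `predScale`. -/
def predDist {n p d : ℕ} (R : ℕ) (X : Matrix (Fin n) (Fin p) ℝ)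
    (Xt : Matrix (Fin d) (Fin p) ℝ) (a₀ b₀ a c γ α : ℝ) (y : Fin n → ℝ) :
    Measure (Fin d → ℝ) :=
  ∑ S : Finset (Fin p),
    ENNReal.ofReal (postModel R X a₀ b₀ a c γ α y S) •
      ((volume : Measure (Fin d → ℝ)).withDensity fun yt =>
        ENNReal.ofReal (tDensity d (2 * a₀ + α * n)
          ((XS Xt S).mulVec (betaHat X S y)) (predScale X Xt a₀ b₀ γ α y S) yt))

/-- The Gaussian limit `N_d(X̃_{S*}β̂_{S*}, σ₀²(I_d + (1/(α+γ))X̃_{S*}(X̃_{S*}ᵀX̃_{S*})⁻¹X̃_{S*}ᵀ))`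
of the posterior predictive distribution. -/
def predLimit {n p d : ℕ} (X : Matrix (Fin n) (Fin p) ℝ)
    (Xt : Matrix (Fin d) (Fin p) ℝ) (γ α σ0sq : ℝ) (y : Fin n → ℝ)
    (S : Finset (Fin p)) : Measure (Fin d → ℝ) :=
  (volume : Measure (Fin d → ℝ)).withDensity fun yt =>
    ENNReal.ofReal (gaussDensity d ((XS Xt S).mulVec (betaHat X S y))
      (σ0sq • ((1 : Matrix (Fin d) (Fin d) ℝ) +
        (α + γ)⁻¹ • (XS Xt S * ((XS Xt S)ᵀ * XS Xt S)⁻¹ * (XS Xt S)ᵀ))) yt)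

lemma Gamma_midpoint_le {s t : ℝ} (hs : 0 < s) (ht : 0 < t) :
    Real.Gamma ((s + t) / 2) ≤ √(Real.Gamma s * Real.Gamma t) := by
  have h := Real.Gamma_mul_add_mul_le_rpow_Gamma_mul_rpow_Gamma hs ht
    (a := 1 / 2) (b := 1 / 2) (by norm_num) (by norm_num) (by norm_num)
  rw [← Real.sqrt_eq_rpow, ← Real.sqrt_eq_rpow, ← Real.sqrt_mul (Real.Gamma_pos_of_pos hs).le] at h
  convert h using 2
  ring

lemma Gamma_add_half_le {x : ℝ} (hx : 0 < x) :
    Real.Gamma (x + 1 / 2) ≤ Real.Gamma x * √x := by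
  have h := Gamma_midpoint_le hx (by linarith : 0 < x + 1)
  have hG := Real.Gamma_pos_of_pos hx
  rw [Real.Gamma_add_one hx.ne',
    show Real.Gamma x * (x * Real.Gamma x) = Real.Gamma x ^ 2 * x by ring,
    Real.sqrt_mul (by positivity), Real.sqrt_sq hG.le] at h
  convert h using 2
  ring

lemma tendsto_Gamma_add_half_div :
    Tendsto (fun x : ℝ => Real.Gamma (x + 1 / 2) / (Real.Gamma x * √x)) atTop (nhds 1) := by
  have hlow : Tendsto (fun x : ℝ => √(1 / (1 + x⁻¹ / 2))) atTop (nhds 1) := by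
    have h : Tendsto (fun x : ℝ => √(1 / (1 + x⁻¹ / 2))) atTop (nhds √(1 / (1 + 0 / 2))) :=
      (tendsto_const_nhds.div ((tendsto_inv_atTop_zero.div_const 2).const_add 1)
        (by norm_num)).sqrt
    simpa using h
  refine tendsto_of_tendsto_of_tendsto_of_le_of_le' hlow tendsto_const_nhds ?_ ?_
  · filter_upwards [eventually_gt_atTop 0] with x hx
    have hG := Real.Gamma_pos_of_pos hx
    have h := Gamma_add_half_le (by linarith : 0 < x + 1 / 2)
    rw [show x + 1 / 2 + 1 / 2 = x + 1 by ring, Real.Gamma_add_one hx.ne'] at h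
    rw [le_div_iff₀ (by positivity), show 1 / (1 + x⁻¹ / 2) = x / (x + 1 / 2) by field_simp,
      Real.sqrt_div hx.le, div_mul_eq_mul_div, div_le_iff₀ (by positivity)]
    calc √x * (Real.Gamma x * √x) = (√x * √x) * Real.Gamma x := by ring
      _ = x * Real.Gamma x := by rw [Real.mul_self_sqrt hx.le]
      _ ≤ _ := h
  · filter_upwards [eventually_gt_atTop 0] with x hx
    have hG := Real.Gamma_pos_of_pos hx
    exact (div_le_one (by positivity)).2 (Gamma_add_half_le hx)

lemma tendsto_Gamma_add_nat_half_div (d : ℕ) :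
    Tendsto (fun x : ℝ => Real.Gamma (x + d / 2) / (Real.Gamma x * √x ^ d)) atTop (nhds 1) := by
  induction d with
  | zero =>
    refine tendsto_const_nhds.congr' ?_
    filter_upwards [eventually_gt_atTop 0] with x hx
    have hG := Real.Gamma_pos_of_pos hx
    simp [hG.ne']
  | succ d ih =>
    have h1 := tendsto_Gamma_add_half_div.comp
      (tendsto_atTop_add_const_right atTop ((d : ℝ) / 2) tendsto_id)
    have h2 : Tendsto (fun x : ℝ => √(1 + x⁻¹ * (d / 2))) atTop (nhds 1) := by
      have h : Tendsto (fun x : ℝ => √(1 + x⁻¹ * (d / 2))) atTop (nhds √(1 + 0 * (d / 2))) :=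
        ((tendsto_inv_atTop_zero.mul_const _).const_add 1).sqrt
      simpa using h
    have h3 := (ih.mul h1).mul h2
    rw [mul_one, mul_one] at h3
    refine h3.congr' ?_
    filter_upwards [eventually_gt_atTop 0] with x hx
    have hx' : 0 < x + d / 2 := by positivity
    have hG := Real.Gamma_pos_of_pos hx
    have hG' := Real.Gamma_pos_of_pos hx'
    have hs : √(1 + x⁻¹ * (d / 2)) = √(x + d / 2) / √x := by
      rw [← Real.sqrt_div hx'.le]
      congr 1
      field_simp
    have h5 : x + ((d + 1 : ℕ) : ℝ) / 2 = x + d / 2 + 1 / 2 := by push_cast; ring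
    rw [hs, h5]
    simp only [Function.comp, id]
    have := Real.sqrt_pos.2 hx
    have := Real.sqrt_pos.2 hx'
    field_simp
    exact pow_succ _ _

/-- Normalizing constant of the multivariate t density with identity scale matrix. -/
def tConst (d : ℕ) (ν : ℝ) : ℝ :=
  Real.Gamma ((ν + d) / 2) / (Real.Gamma (ν / 2) * ν ^ ((d : ℝ) / 2) * π ^ ((d : ℝ) / 2))

lemma tConst_pos (d : ℕ) {ν : ℝ} (hν : 0 < ν) : 0 < tConst d ν := by
  unfold tConst
  have := Real.Gamma_pos_of_pos (by positivity : 0 < ν / 2)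
  have := Real.Gamma_pos_of_pos (by positivity : 0 < (ν + d) / 2)
  positivity

lemma tendsto_tConst (d : ℕ) :
    Tendsto (tConst d) atTop (nhds ((2 * π) ^ (-(d : ℝ) / 2))) := by
  have h := ((tendsto_Gamma_add_nat_half_div d).comp
    (tendsto_id.atTop_div_const (by norm_num : (0 : ℝ) < 2))).mul_const
      ((2 * π) ^ (-(d : ℝ) / 2))
  rw [one_mul] at h
  refine h.congr' ?_
  filter_upwards [eventually_gt_atTop 0] with ν hν
  have hG := Real.Gamma_pos_of_pos (by positivity : 0 < ν / 2)
  simp only [Function.comp, id, tConst]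
  have h1 : √(ν / 2) ^ d = (ν / 2) ^ ((d : ℝ) / 2) := by
    rw [Real.sqrt_eq_rpow, ← Real.rpow_natCast, ← Real.rpow_mul (by positivity)]
    congr 1; ring
  rw [h1, show ν / 2 + (d : ℝ) / 2 = (ν + d) / 2 by ring, neg_div, Real.rpow_neg (by positivity),
    Real.div_rpow hν.le (by norm_num), Real.mul_rpow (by norm_num) pi_pos.le]
  have : 0 < (2 : ℝ) ^ ((d : ℝ) / 2) := by positivity
  have : 0 < π ^ ((d : ℝ) / 2) := by positivity
  have : 0 < ν ^ ((d : ℝ) / 2) := by positivity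
  field_simp

lemma tendsto_student_kernel (d : ℕ) {q : ℝ} (hq : 0 ≤ q) :
    Tendsto (fun z : ℝ × ℝ => (1 + z.1⁻¹ * (z.2⁻¹ * q)) ^ (-(z.1 + d) / 2))
      (atTop ×ˢ nhds 1) (nhds (Real.exp (-q / 2))) := by
  have hν : Tendsto (fun z : ℝ × ℝ => z.1⁻¹) (atTop ×ˢ nhds 1) (nhds 0) :=
    tendsto_inv_atTop_zero.comp tendsto_fst
  have hr : Tendsto (fun z : ℝ × ℝ => z.2⁻¹ * q) (atTop ×ˢ nhds 1) (nhds q) := by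
    have h : Tendsto (fun z : ℝ × ℝ => z.2) (atTop ×ˢ nhds (1 : ℝ)) (nhds 1) := tendsto_snd
    simpa using (h.inv₀ one_ne_zero).mul_const q
  have hx := hν.mul hr
  have hu : Tendsto (fun z : ℝ × ℝ => (1 + d * z.1⁻¹) / 2 * (z.2⁻¹ * q)) (atTop ×ˢ nhds 1)
      (nhds (q / 2)) := by
    have h := (((hν.const_mul (d : ℝ)).const_add 1).div_const 2).mul hr
    convert h using 2
    ring
  have hl : Tendsto (fun z : ℝ × ℝ => (1 + d * z.1⁻¹) / 2 * (z.2⁻¹ * q) /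
      (1 + z.1⁻¹ * (z.2⁻¹ * q))) (atTop ×ˢ nhds 1) (nhds (q / 2)) := by
    have h := hu.div (hx.const_add 1) (by norm_num)
    rwa [zero_mul, add_zero, div_one] at h
  have hev : ∀ᶠ z : ℝ × ℝ in atTop ×ˢ nhds 1, 0 < z.1 ∧ 0 < z.2 :=
    (eventually_gt_atTop 0).prod_mk (lt_mem_nhds one_pos)
  have hlog : Tendsto (fun z : ℝ × ℝ => (z.1 + d) / 2 * Real.log (1 + z.1⁻¹ * (z.2⁻¹ * q)))
      (atTop ×ˢ nhds 1) (nhds (q / 2)) := by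
    refine tendsto_of_tendsto_of_tendsto_of_le_of_le' hl hu ?_ ?_
    · filter_upwards [hev] with z hz
      obtain ⟨h1, h2⟩ := hz
      have hy : 0 ≤ z.1⁻¹ * (z.2⁻¹ * q) := by positivity
      have h3 := Real.one_sub_inv_le_log_of_pos (by linarith : 0 < 1 + z.1⁻¹ * (z.2⁻¹ * q))
      have h4 := mul_le_mul_of_nonneg_left h3 (by positivity : 0 ≤ (z.1 + d) / 2)
      refine le_trans (le_of_eq ?_) h4
      have : 1 + z.1⁻¹ * (z.2⁻¹ * q) ≠ 0 := by positivity
      have h5 : 1 - (1 + z.1⁻¹ * (z.2⁻¹ * q))⁻¹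
          = z.1⁻¹ * (z.2⁻¹ * q) / (1 + z.1⁻¹ * (z.2⁻¹ * q)) := by
        field_simp
        ring
      rw [h5, ← mul_div_assoc]
      congr 1
      field_simp
    · filter_upwards [hev] with z hz
      obtain ⟨h1, h2⟩ := hz
      have hy : 0 ≤ z.1⁻¹ * (z.2⁻¹ * q) := by positivity
      have h3 := Real.log_le_sub_one_of_pos (by linarith : 0 < 1 + z.1⁻¹ * (z.2⁻¹ * q))
      have h4 := mul_le_mul_of_nonneg_left h3 (by positivity : 0 ≤ (z.1 + d) / 2)
      refine h4.trans (le_of_eq ?_)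
      field_simp
      ring
  have h := (Real.continuous_exp.tendsto _).comp hlog.neg
  rw [← neg_div] at h
  refine h.congr' ?_
  filter_upwards [hev] with z hz
  obtain ⟨h1, h2⟩ := hz
  rw [Real.rpow_def_of_pos (by positivity)]
  simp only [Function.comp]
  congr 1
  ring

lemma student_kernel_le {d : ℕ} {ν r q : ℝ} (hν : (d : ℝ) + 1 ≤ ν) (hr : 0 < r) (hr2 : r ≤ 2)
    (hq : 0 ≤ q) : (1 + ν⁻¹ * (r⁻¹ * q)) ^ (-(ν + d) / 2) ≤
      (1 + q / (2 * (d + 1))) ^ (-((d : ℝ) + 1) / 2) := by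
  have hd : (0 : ℝ) < d + 1 := by positivity
  have hν0 : 0 < ν := hd.trans_le hν
  have h1 : 1 + q / (2 * ν) ≤ 1 + ν⁻¹ * (r⁻¹ * q) := by
    have : ν⁻¹ * (r⁻¹ * q) = q / (r * ν) := by field_simp
    rw [this]
    gcongr
  have h2 : 1 + q / (2 * (d + 1)) ≤ (1 + q / (2 * ν)) ^ (ν / (d + 1)) := by
    have := one_add_mul_self_le_rpow_one_add (s := q / (2 * ν))
      (by have : 0 ≤ q / (2 * ν) := by positivity
          linarith) (p := ν / (d + 1)) ((one_le_div hd).2 hν)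
    refine le_trans (le_of_eq ?_) this
    field_simp
  have h0 : 0 ≤ q / (2 * ν) := by positivity
  have h0' : 0 ≤ ν⁻¹ * (r⁻¹ * q) := by positivity
  calc (1 + ν⁻¹ * (r⁻¹ * q)) ^ (-(ν + d) / 2)
      ≤ (1 + ν⁻¹ * (r⁻¹ * q)) ^ (-ν / 2) := by
        apply Real.rpow_le_rpow_of_exponent_le (by linarith)
        have : (0 : ℝ) ≤ d := by positivity
        linarith
    _ ≤ (1 + q / (2 * ν)) ^ (-ν / 2) :=
        Real.rpow_le_rpow_of_nonpos (by positivity) h1 (by linarith)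
    _ = ((1 + q / (2 * ν)) ^ (ν / (d + 1))) ^ (-((d : ℝ) + 1) / 2) := by
        rw [← Real.rpow_mul (by positivity)]
        congr 1
        field_simp
    _ ≤ _ := Real.rpow_le_rpow_of_nonpos (by positivity) h2 (by linarith)

/-- Multivariate t density with location `0` and scale matrix `r • 1`. -/
def stdStudent (d : ℕ) (ν r : ℝ) (u : Fin d → ℝ) : ℝ :=
  tConst d ν * (√(r ^ d))⁻¹ * (1 + ν⁻¹ * (r⁻¹ * (u ⬝ᵥ u))) ^ (-(ν + d) / 2)

/-- Standard Gaussian density on `ℝ^d`. -/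
def stdGauss (d : ℕ) (u : Fin d → ℝ) : ℝ :=
  (2 * π) ^ (-(d : ℝ) / 2) * Real.exp (-(u ⬝ᵥ u) / 2)

lemma dotProduct_self_nonneg_real {d : ℕ} (u : Fin d → ℝ) : 0 ≤ u ⬝ᵥ u :=
  Finset.sum_nonneg fun i _ => mul_self_nonneg (u i)

lemma stdStudent_nonneg {d : ℕ} {ν r : ℝ} (hν : 0 < ν) (hr : 0 < r) (u : Fin d → ℝ) :
    0 ≤ stdStudent d ν r u := by
  have := dotProduct_self_nonneg_real u
  have := tConst_pos d hν
  unfold stdStudent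
  positivity

lemma stdGauss_nonneg {d : ℕ} (u : Fin d → ℝ) : 0 ≤ stdGauss d u := by
  unfold stdGauss
  positivity

lemma measurable_stdStudent (d : ℕ) (ν r : ℝ) : Measurable (stdStudent d ν r) := by
  unfold stdStudent dotProduct
  fun_prop

lemma measurable_stdGauss (d : ℕ) : Measurable (stdGauss d) := by
  unfold stdGauss dotProduct
  fun_prop

open scoped MatrixOrder in
/-- Whitening matrix of a positive definite scale matrix. -/
lemma exists_whitening {d : ℕ} {W : Matrix (Fin d) (Fin d) ℝ} (hW : W.PosDef) :
    ∃ M : Matrix (Fin d) (Fin d) ℝ, W⁻¹ = Mᵀ * M ∧ M.det ≠ 0 ∧ √W.det = |M.det|⁻¹ := by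
  obtain ⟨M, hM⟩ := CStarAlgebra.nonneg_iff_eq_star_mul_self.mp hW.inv.posSemidef.nonneg
  rw [star_eq_conjTranspose, conjTranspose_eq_transpose_of_trivial] at hM
  have hdet : W.det⁻¹ = M.det ^ 2 := by
    have h := congrArg Matrix.det hM
    rw [Matrix.det_nonsing_inv, Ring.inverse_eq_inv', Matrix.det_mul, Matrix.det_transpose] at h
    rw [h, sq]
  refine ⟨M, hM, ?_, ?_⟩
  · intro h
    rw [h] at hdet
    exact (inv_pos.2 hW.det_pos).ne' (by simpa using hdet)
  · rw [← inv_inv W.det, hdet, Real.sqrt_inv, Real.sqrt_sq_eq_abs]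

lemma inv_smul_real {d : ℕ} {W : Matrix (Fin d) (Fin d) ℝ} (hW : W.PosDef) {r : ℝ} (hr : 0 < r) :
    (r • W)⁻¹ = r⁻¹ • W⁻¹ := by
  let : Invertible r := invertibleOfNonzero hr.ne'
  rw [Matrix.inv_smul W r hW.det_pos.ne'.isUnit, invOf_eq_inv]

lemma dotProduct_whitening {d : ℕ} {W M : Matrix (Fin d) (Fin d) ℝ} (h : W⁻¹ = Mᵀ * M)
    (v : Fin d → ℝ) : v ⬝ᵥ (W⁻¹ *ᵥ v) = (M *ᵥ v) ⬝ᵥ (M *ᵥ v) := by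
  rw [h, ← Matrix.mulVec_mulVec, Matrix.dotProduct_mulVec, Matrix.vecMul_transpose]

lemma tDensity_smul_eq {d : ℕ} {W M : Matrix (Fin d) (Fin d) ℝ} (hW : W.PosDef)
    (hM : W⁻¹ = Mᵀ * M) (hdet : √W.det = |M.det|⁻¹) (ν : ℝ) {r : ℝ} (hr : 0 < r)
    (m x : Fin d → ℝ) :
    tDensity d ν m (r • W) x = |M.det| * stdStudent d ν r (M *ᵥ (x - m)) := by
  unfold tDensity stdStudent tConst
  rw [inv_smul_real hW hr, Matrix.smul_mulVec, dotProduct_smul, dotProduct_whitening hM,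
    Matrix.det_smul, Fintype.card_fin, Real.sqrt_mul (by positivity), hdet, smul_eq_mul,
    ← mul_assoc |M.det|]
  congr 1
  simp only [div_eq_mul_inv, mul_inv, inv_inv]
  ring

lemma gaussDensity_eq {d : ℕ} {W M : Matrix (Fin d) (Fin d) ℝ}
    (hM : W⁻¹ = Mᵀ * M) (hdet : √W.det = |M.det|⁻¹) (m x : Fin d → ℝ) :
    gaussDensity d m W x = |M.det| * stdGauss d (M *ᵥ (x - m)) := by
  unfold gaussDensity stdGauss
  rw [dotProduct_whitening hM, hdet, inv_inv]
  ring

lemma lintegral_comp_affine {d : ℕ} {M : Matrix (Fin d) (Fin d) ℝ} (hM : M.det ≠ 0)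
    (m : Fin d → ℝ) {F : (Fin d → ℝ) → ℝ≥0∞} (hF : Measurable F) :
    ∫⁻ x, ENNReal.ofReal |M.det| * F (M *ᵥ (x - m)) = ∫⁻ u, F u := by
  have hlin : Measurable (fun x : Fin d → ℝ => M *ᵥ x) := by
    have : Continuous (fun x : Fin d → ℝ => M *ᵥ x) := by fun_prop
    exact this.measurable
  have hcomp : Measurable fun x => F (M *ᵥ (x - m)) :=
    hF.comp (hlin.comp (measurable_id.sub_const m))
  rw [lintegral_const_mul _ hcomp,
    lintegral_sub_right_eq_self (fun x => F (M *ᵥ x)) m]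
  have h := Real.map_matrix_volume_pi_eq_smul_volume_pi hM
  have h2 : ∫⁻ x, F (M *ᵥ x) = ENNReal.ofReal |M.det⁻¹| * ∫⁻ u, F u := by
    rw [← smul_eq_mul, ← lintegral_smul_measure, ← h]
    exact (lintegral_map hF (toLin' M).continuous_of_finiteDimensional.measurable).symm
  rw [h2, ← mul_assoc, ← ENNReal.ofReal_mul (abs_nonneg _), ← abs_mul, mul_inv_cancel₀ hM]
  simp

/-- `L¹` distance between the standardized t density and the standard Gaussian density. -/
def studentGaussDist (d : ℕ) (ν r : ℝ) : ℝ≥0∞ :=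
  ∫⁻ u : Fin d → ℝ, ENNReal.ofReal |stdStudent d ν r u - stdGauss d u|

lemma withDensity_tDensity_univ {d : ℕ} {W : Matrix (Fin d) (Fin d) ℝ} (hW : W.PosDef) (ν : ℝ)
    (m : Fin d → ℝ) :
    ((volume : Measure (Fin d → ℝ)).withDensity fun x => ENNReal.ofReal (tDensity d ν m W x))
      Set.univ = ∫⁻ u, ENNReal.ofReal (stdStudent d ν 1 u) := by
  obtain ⟨M, hM, hM0, hdet⟩ := exists_whitening hW
  rw [withDensity_apply _ MeasurableSet.univ, setLIntegral_univ,
    ← lintegral_comp_affine hM0 m (measurable_stdStudent d ν 1).ennreal_ofReal]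
  refine lintegral_congr fun x => ?_
  have h := tDensity_smul_eq hW hM hdet ν one_pos m x
  rw [one_smul] at h
  rw [h, ENNReal.ofReal_mul (abs_nonneg _)]

lemma withDensity_gaussDensity_univ {d : ℕ} {W : Matrix (Fin d) (Fin d) ℝ} (hW : W.PosDef)
    (m : Fin d → ℝ) :
    ((volume : Measure (Fin d → ℝ)).withDensity fun x => ENNReal.ofReal (gaussDensity d m W x))
      Set.univ = ∫⁻ u, ENNReal.ofReal (stdGauss d u) := by
  obtain ⟨M, hM, hM0, hdet⟩ := exists_whitening hW
  rw [withDensity_apply _ MeasurableSet.univ, setLIntegral_univ,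
    ← lintegral_comp_affine hM0 m (measurable_stdGauss d).ennreal_ofReal]
  refine lintegral_congr fun x => ?_
  rw [gaussDensity_eq hM hdet, ENNReal.ofReal_mul (abs_nonneg _)]

lemma withDensity_apply_le_add {E : Type*} [MeasurableSpace E] {μ : Measure E} {f g : E → ℝ}
    (hfg : Measurable fun x => |f x - g x|) {A : Set E} (hA : MeasurableSet A) :
    μ.withDensity (fun x => ENNReal.ofReal (f x)) A ≤
      μ.withDensity (fun x => ENNReal.ofReal (g x)) A + ∫⁻ x, ENNReal.ofReal |f x - g x| ∂μ := by
  rw [withDensity_apply _ hA, withDensity_apply _ hA]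
  calc ∫⁻ x in A, ENNReal.ofReal (f x) ∂μ
      ≤ ∫⁻ x in A, (ENNReal.ofReal (g x) + ENNReal.ofReal |f x - g x|) ∂μ := by
        refine lintegral_mono fun x => ?_
        refine le_trans (ENNReal.ofReal_le_ofReal ?_) ENNReal.ofReal_add_le
        have := le_abs_self (f x - g x)
        linarith
    _ = ∫⁻ x in A, ENNReal.ofReal (g x) ∂μ + ∫⁻ x in A, ENNReal.ofReal |f x - g x| ∂μ :=
        lintegral_add_right _ hfg.ennreal_ofReal
    _ ≤ _ := by gcongr; exact Measure.restrict_le_self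

lemma lintegral_abs_tDensity_sub_gaussDensity {d : ℕ} {W : Matrix (Fin d) (Fin d) ℝ}
    (hW : W.PosDef) (ν : ℝ) {r : ℝ} (hr : 0 < r) (m : Fin d → ℝ) :
    Measurable (fun x => |tDensity d ν m (r • W) x - gaussDensity d m W x|) ∧
    ∫⁻ x, ENNReal.ofReal |tDensity d ν m (r • W) x - gaussDensity d m W x| =
      studentGaussDist d ν r := by
  obtain ⟨M, hM, hM0, hdet⟩ := exists_whitening hW
  have hmeas : Measurable fun u => |stdStudent d ν r u - stdGauss d u| :=
    ((measurable_stdStudent d ν r).sub (measurable_stdGauss d)).abs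
  have hlin : Measurable (fun x : Fin d → ℝ => M *ᵥ (x - m)) := by
    have : Continuous (fun x : Fin d → ℝ => M *ᵥ (x - m)) := by fun_prop
    exact this.measurable
  have h : ∀ x, |tDensity d ν m (r • W) x - gaussDensity d m W x| =
      |M.det| * |stdStudent d ν r (M *ᵥ (x - m)) - stdGauss d (M *ᵥ (x - m))| := fun x => by
    rw [gaussDensity_eq hM hdet, tDensity_smul_eq hW hM hdet ν hr, ← mul_sub, abs_mul, abs_abs]
  refine ⟨?_, ?_⟩
  · simp_rw [h]
    exact (hmeas.comp hlin).const_mul _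
  · rw [studentGaussDist, ← lintegral_comp_affine hM0 m hmeas.ennreal_ofReal]
    exact lintegral_congr fun x => by rw [h, ENNReal.ofReal_mul (abs_nonneg _)]

lemma lintegral_student_dominant_ne_top (d : ℕ) (K : ℝ) :
    ∫⁻ u : Fin d → ℝ, ENNReal.ofReal
      (K * (1 + (u ⬝ᵥ u) / (2 * (d + 1))) ^ (-((d : ℝ) + 1) / 2)) ≠ ⊤ := by
  have hd : (1 : ℝ) ≤ 2 * (d + 1) := by
    have : (0 : ℝ) ≤ d := by positivity
    linarith
  have hint := integrable_rpow_neg_one_add_norm_sq (E := Fin d → ℝ) (μ := volume)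
    (r := (d : ℝ) + 1) (by simp)
  have hint2 := hint.const_mul ((2 * ((d : ℝ) + 1))⁻¹ ^ (-((d : ℝ) + 1) / 2))
  have hmeas : Measurable fun u : Fin d → ℝ =>
      (1 + (u ⬝ᵥ u) / (2 * (d + 1))) ^ (-((d : ℝ) + 1) / 2) := by
    unfold dotProduct
    fun_prop
  have h3 : Integrable fun u : Fin d → ℝ =>
      (1 + (u ⬝ᵥ u) / (2 * (d + 1))) ^ (-((d : ℝ) + 1) / 2) := by
    refine hint2.mono' hmeas.aestronglyMeasurable (ae_of_all _ fun u => ?_)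
    have hu := dotProduct_self_nonneg_real u
    rw [Real.norm_of_nonneg (by positivity), ← Real.mul_rpow (by positivity) (by positivity)]
    refine Real.rpow_le_rpow_of_nonpos (by positivity) ?_ (by linarith)
    have hnorm : ‖u‖ ^ 2 ≤ u ⬝ᵥ u := by
      have h1 : ‖u‖ ≤ √(u ⬝ᵥ u) := by
        refine (pi_norm_le_iff_of_nonneg (Real.sqrt_nonneg _)).2 fun i => ?_
        rw [Real.norm_eq_abs]
        refine Real.abs_le_sqrt ?_
        rw [sq]
        exact Finset.single_le_sum (f := fun i => u i * u i)
          (fun j _ => mul_self_nonneg _) (Finset.mem_univ i)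
      calc ‖u‖ ^ 2 ≤ √(u ⬝ᵥ u) ^ 2 := by gcongr
        _ = _ := Real.sq_sqrt hu
    rw [inv_mul_eq_div, div_le_iff₀ (by positivity), add_mul, div_mul_cancel₀ _ (by positivity)]
    linarith
  exact (h3.const_mul K).lintegral_lt_top.ne

lemma stdGauss_le (d : ℕ) (u : Fin d → ℝ) : stdGauss d u ≤ (2 * π) ^ (-(d : ℝ) / 2) *
    (1 + (u ⬝ᵥ u) / (2 * (d + 1))) ^ (-((d : ℝ) + 1) / 2) := by
  have hu := dotProduct_self_nonneg_real u
  unfold stdGauss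
  gcongr
  calc Real.exp (-(u ⬝ᵥ u) / 2) = Real.exp ((u ⬝ᵥ u) / (d + 1)) ^ (-((d : ℝ) + 1) / 2) := by
        rw [← Real.exp_mul]
        congr 1
        field_simp
    _ ≤ _ := by
        refine Real.rpow_le_rpow_of_nonpos (by positivity) ?_ ?_
        · have h1 := Real.add_one_le_exp ((u ⬝ᵥ u) / (d + 1))
          have h2 : (u ⬝ᵥ u) / (2 * (d + 1)) ≤ (u ⬝ᵥ u) / (d + 1) := by
            gcongr
            have : (0 : ℝ) ≤ d := by positivity
            linarith
          linarith
        · have : (0 : ℝ) ≤ d := by positivity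
          linarith

lemma lintegral_stdGauss_ne_top (d : ℕ) :
    ∫⁻ u : Fin d → ℝ, ENNReal.ofReal (stdGauss d u) ≠ ⊤ :=
  ne_top_of_le_ne_top (lintegral_student_dominant_ne_top d _)
    (lintegral_mono fun u => ENNReal.ofReal_le_ofReal (stdGauss_le d u))

lemma tendsto_studentGaussDist (d : ℕ) :
    Tendsto (fun z : ℝ × ℝ => studentGaussDist d z.1 z.2) (atTop ×ˢ nhds 1) (nhds 0) := by
  set G := (2 * π) ^ (-(d : ℝ) / 2) with hG
  have hcoef : Tendsto (fun z : ℝ × ℝ => tConst d z.1 * (√(z.2 ^ d))⁻¹)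
      (atTop ×ˢ nhds 1) (nhds G) := by
    have h1 : Tendsto (fun z : ℝ × ℝ => z.2) (atTop ×ˢ nhds (1 : ℝ)) (nhds 1) := tendsto_snd
    have h2 := ((h1.pow d).sqrt).inv₀ (by simp)
    simpa using ((tendsto_tConst d).comp tendsto_fst).mul h2
  have hev : ∀ᶠ z : ℝ × ℝ in atTop ×ˢ nhds 1, (d : ℝ) + 1 ≤ z.1 ∧ (0 < z.2 ∧ z.2 < 2) :=
    (eventually_ge_atTop _).prod_mk ((lt_mem_nhds one_pos).and (gt_mem_nhds one_lt_two))
  have hlim := tendsto_lintegral_filter_of_dominated_convergence (μ := (volume : Measure (Fin d → ℝ)))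
    (l := (atTop ×ˢ nhds 1 : Filter (ℝ × ℝ)))
    (F := fun z u => ENNReal.ofReal |stdStudent d z.1 z.2 u - stdGauss d u|) (f := fun _ => 0)
    (fun u => ENNReal.ofReal ((2 * G + 1) *
      (1 + (u ⬝ᵥ u) / (2 * (d + 1))) ^ (-((d : ℝ) + 1) / 2)))
    (Eventually.of_forall fun z =>
      ((measurable_stdStudent d _ _).sub (measurable_stdGauss d)).abs.ennreal_ofReal)
    ?_ (lintegral_student_dominant_ne_top d _) ?_
  · simpa [studentGaussDist] using hlim
  · filter_upwards [hev, hcoef.eventually_lt_const (lt_add_one G)] with z hz hz2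
    refine ae_of_all _ fun u => ENNReal.ofReal_le_ofReal ?_
    obtain ⟨h1, h2, h3⟩ := hz
    have hu := dotProduct_self_nonneg_real u
    have hν : 0 < z.1 := lt_of_lt_of_le (by positivity) h1
    have hk := student_kernel_le h1 h2 h3.le hu
    have hs : stdStudent d z.1 z.2 u ≤ (G + 1) *
        (1 + (u ⬝ᵥ u) / (2 * (d + 1))) ^ (-((d : ℝ) + 1) / 2) := by
      unfold stdStudent
      have := tConst_pos d hν
      exact mul_le_mul hz2.le hk (by positivity) (by positivity)
    have hg := stdGauss_le d u
    have hs0 := stdStudent_nonneg hν h2 u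
    have hg0 := stdGauss_nonneg u
    rw [abs_le]
    rw [← hG] at hg
    have hpos : 0 ≤ (1 + (u ⬝ᵥ u) / (2 * ((d : ℝ) + 1))) ^ (-((d : ℝ) + 1) / 2) := by positivity
    have hGpos : 0 ≤ G := by positivity
    constructor <;> nlinarith [mul_nonneg hGpos hpos]
  · refine ae_of_all _ fun u => ?_
    have h := hcoef.mul (tendsto_student_kernel d (dotProduct_self_nonneg_real u))
    have h2 := (h.sub_const (stdGauss d u)).abs
    rw [stdGauss, ← hG, sub_self, abs_zero] at h2
    have h3 := (ENNReal.continuous_ofReal.tendsto 0).comp h2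
    rw [ENNReal.ofReal_zero] at h3
    refine h3.congr fun z => ?_
    simp only [Function.comp, stdStudent, stdGauss, hG]

lemma lintegral_stdStudent_le (d : ℕ) (ν : ℝ) :
    ∫⁻ u, ENNReal.ofReal (stdStudent d ν 1 u) ≤
      (∫⁻ u, ENNReal.ofReal (stdGauss d u)) + studentGaussDist d ν 1 := by
  have h := withDensity_apply_le_add (μ := (volume : Measure (Fin d → ℝ)))
    (((measurable_stdStudent d ν 1).sub (measurable_stdGauss d)).abs) MeasurableSet.univ
  simpa [withDensity_apply, studentGaussDist] using h

section Distances

variable {E : Type*} [MeasurableSpace E]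

lemma tvDist_nonneg (P Q : Measure E) : 0 ≤ tvDist P Q :=
  Real.iSup_nonneg fun _ => abs_nonneg _

lemma sqHellinger_nonneg (P Q : Measure E) : 0 ≤ sqHellinger P Q :=
  integral_nonneg fun _ => sq_nonneg _

lemma abs_sub_le_tvDist (P Q : Measure E) [IsFiniteMeasure P] [IsFiniteMeasure Q]
    {A : Set E} (hA : MeasurableSet A) : |P.real A - Q.real A| ≤ tvDist P Q := by
  refine le_ciSup (f := fun A : {A : Set E // MeasurableSet A} =>
    |(P A).toReal - (Q A).toReal|) ?_ ⟨A, hA⟩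
  refine ⟨P.real Set.univ + Q.real Set.univ, ?_⟩
  rintro _ ⟨B, rfl⟩
  change |P.real B - Q.real B| ≤ _
  have h1 : P.real B ≤ P.real Set.univ := measureReal_mono (Set.subset_univ _)
  have h2 : Q.real B ≤ Q.real Set.univ := measureReal_mono (Set.subset_univ _)
  have h3 : 0 ≤ P.real B := measureReal_nonneg
  have h4 : 0 ≤ Q.real B := measureReal_nonneg
  rw [abs_le]
  constructor <;> linarith

lemma sq_sqrt_sub_sqrt_le {x y : ℝ} (hx : 0 ≤ x) (hy : 0 ≤ y) : (√x - √y) ^ 2 ≤ |x - y| := by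
  have h : x - y = (√x - √y) * (√x + √y) := by
    linear_combination -(Real.sq_sqrt hx) + Real.sq_sqrt hy
  have hs : |√x - √y| ≤ √x + √y := by
    have := Real.sqrt_nonneg x
    have := Real.sqrt_nonneg y
    rw [abs_le]
    constructor <;> linarith
  rw [h, abs_mul, ← sq_abs, sq, abs_of_nonneg (by positivity : 0 ≤ √x + √y)]
  gcongr

lemma sqHellinger_le_two_mul_tvDist (P Q : Measure E) [IsFiniteMeasure P] [IsFiniteMeasure Q] :
    sqHellinger P Q ≤ 2 * tvDist P Q := by
  set f := fun x => (P.rnDeriv (P + Q) x).toReal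
  set g := fun x => (Q.rnDeriv (P + Q) x).toReal
  have hP : P ≪ P + Q := Measure.absolutelyContinuous_of_le (Measure.le_add_right le_rfl)
  have hQ : Q ≪ P + Q := Measure.absolutelyContinuous_of_le (Measure.le_add_left le_rfl)
  have hf : Integrable f (P + Q) := Measure.integrable_toReal_rnDeriv
  have hg : Integrable g (P + Q) := Measure.integrable_toReal_rnDeriv
  have hfm : Measurable f := (Measure.measurable_rnDeriv _ _).ennreal_toReal
  have hgm : Measurable g := (Measure.measurable_rnDeriv _ _).ennreal_toReal
  have hA : MeasurableSet {x | g x ≤ f x} := measurableSet_le hgm hfm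
  have h1 : sqHellinger P Q ≤ ∫ x, |f x - g x| ∂(P + Q) :=
    integral_mono_of_nonneg (ae_of_all _ fun x => sq_nonneg _) (hf.sub hg).abs
      (ae_of_all _ fun x => sq_sqrt_sub_sqrt_le ENNReal.toReal_nonneg ENNReal.toReal_nonneg)
  have h2 : ∫ x in {x | g x ≤ f x}, |f x - g x| ∂(P + Q) =
      P.real {x | g x ≤ f x} - Q.real {x | g x ≤ f x} := by
    rw [← Measure.setIntegral_toReal_rnDeriv hP, ← Measure.setIntegral_toReal_rnDeriv hQ,
      ← integral_sub hf.integrableOn hg.integrableOn]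
    exact setIntegral_congr_fun hA fun x hx => abs_of_nonneg (sub_nonneg.2 hx)
  have h3 : ∫ x in {x | g x ≤ f x}ᶜ, |f x - g x| ∂(P + Q) =
      Q.real {x | g x ≤ f x}ᶜ - P.real {x | g x ≤ f x}ᶜ := by
    rw [← Measure.setIntegral_toReal_rnDeriv hP, ← Measure.setIntegral_toReal_rnDeriv hQ,
      ← integral_sub hg.integrableOn hf.integrableOn]
    refine setIntegral_congr_fun hA.compl fun x hx => ?_
    have hx' : f x < g x := not_le.1 hx
    change |f x - g x| = g x - f x
    rw [abs_of_nonpos (by linarith)]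
    ring
  have habs : Integrable (fun x => |f x - g x|) (P + Q) := (hf.sub hg).abs
  rw [← integral_add_compl hA habs, h2, h3] at h1
  have h4 := (le_abs_self _).trans (abs_sub_le_tvDist P Q hA)
  have h5 := (neg_le_abs _).trans (abs_sub_le_tvDist P Q hA.compl)
  linarith

/-- A finite mixture is close in total variation to a measure that is close to its dominant
component. -/
lemma tvDist_mixture_le {ι : Type*} [Fintype ι] {w : ι → ℝ} (hw0 : ∀ i, 0 ≤ w i)
    (hw1 : ∑ i, w i = 1) {T : ι → Measure E} {Q : Measure E} {C D : ℝ} (hC : 0 ≤ C)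
    (hT : ∀ i, T i Set.univ ≤ ENNReal.ofReal C) (hQ : Q Set.univ ≤ ENNReal.ofReal C) (i₀ : ι)
    (hD : ∀ A, MeasurableSet A → |(T i₀).real A - Q.real A| ≤ D) :
    tvDist (∑ i, ENNReal.ofReal (w i) • T i) Q ≤ (1 - w i₀) * C + D := by
  have hfin : ∀ i, T i Set.univ ≠ ⊤ := fun i => ne_top_of_le_ne_top ENNReal.ofReal_ne_top (hT i)
  have hle : ∀ {μ : Measure E}, μ Set.univ ≤ ENNReal.ofReal C → ∀ A, μ.real A ≤ C := fun h A =>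
    ENNReal.toReal_le_of_le_ofReal hC ((measure_mono (Set.subset_univ A)).trans h)
  refine ciSup_le fun A => ?_
  obtain ⟨A, hA⟩ := A
  have hP : ((∑ i, ENNReal.ofReal (w i) • T i) A).toReal = ∑ i, w i * (T i).real A := by
    rw [Measure.coe_finsetSum, Finset.sum_apply, ENNReal.toReal_sum]
    · refine Finset.sum_congr rfl fun i _ => ?_
      rw [Measure.smul_apply, smul_eq_mul, ENNReal.toReal_mul, ENNReal.toReal_ofReal (hw0 i)]
      rfl
    · intro i _
      rw [Measure.smul_apply, smul_eq_mul]
      exact ENNReal.mul_ne_top ENNReal.ofReal_ne_top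
        (ne_top_of_le_ne_top (hfin i) (measure_mono (Set.subset_univ A)))
  change |((∑ i, ENNReal.ofReal (w i) • T i) A).toReal - Q.real A| ≤ _
  have hsplit : ∑ i, w i * (T i).real A - Q.real A = ∑ i, w i * ((T i).real A - Q.real A) := by
    simp_rw [mul_sub]
    rw [Finset.sum_sub_distrib, ← Finset.sum_mul, hw1, one_mul]
  have hq := hle hQ A
  have hq0 : 0 ≤ Q.real A := measureReal_nonneg
  have hw_i₀ : w i₀ ≤ 1 := hw1 ▸ Finset.single_le_sum (fun i _ => hw0 i) (Finset.mem_univ i₀)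
  rw [hP, hsplit]
  calc |∑ i, w i * ((T i).real A - Q.real A)|
      ≤ ∑ i, w i * |(T i).real A - Q.real A| := by
        refine (Finset.abs_sum_le_sum_abs _ _).trans (Finset.sum_le_sum fun i _ => ?_)
        rw [abs_mul, abs_of_nonneg (hw0 i)]
    _ ≤ ∑ i ∈ Finset.univ.erase i₀, w i * C + w i₀ * D := by
        rw [← Finset.sum_erase_add _ _ (Finset.mem_univ i₀)]
        gcongr with i _
        · exact hw0 i
        · have h1 := hle (hT i) A
          have h2 : 0 ≤ (T i).real A := measureReal_nonneg
          rw [abs_le]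
          constructor <;> linarith
        · exact hw0 i₀
        · exact hD A hA
    _ = (1 - w i₀) * C + w i₀ * D := by
        rw [← Finset.sum_mul, ← hw1, ← Finset.sum_erase_add _ _ (Finset.mem_univ i₀)]
        ring
    _ ≤ (1 - w i₀) * C + D := by
        have hD0 : 0 ≤ D := (abs_nonneg _).trans (hD A hA)
        have := mul_le_of_le_one_left hD0 hw_i₀
        linarith

end Distances

section Predictive

variable {n p d : ℕ}

lemma rss_nonneg (X : Matrix (Fin n) (Fin p) ℝ) (S : Finset (Fin p)) (y : Fin n → ℝ) :
    0 ≤ rss X S y := Finset.sum_nonneg fun _ _ => sq_nonneg _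

lemma modelWt_nonneg {R : ℕ} (X : Matrix (Fin n) (Fin p) ℝ) {a₀ b₀ a c γ α : ℝ}
    (hb₀ : 0 < b₀) (hc : 0 < c) (hγ : 0 < γ) (hα : 0 < α) (y : Fin n → ℝ) (S : Finset (Fin p)) :
    0 ≤ modelWt R X a₀ b₀ a c γ α y S := by
  have := rss_nonneg X S y
  unfold modelWt priorWt
  split_ifs <;> positivity

lemma sum_modelWt_pos {R : ℕ} (X : Matrix (Fin n) (Fin p) ℝ) {a₀ b₀ a c γ α : ℝ}
    (hb₀ : 0 < b₀) (hc : 0 < c) (hγ : 0 < γ) (hα : 0 < α) (y : Fin n → ℝ) :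
    0 < ∑ S : Finset (Fin p), modelWt R X a₀ b₀ a c γ α y S := by
  refine Finset.sum_pos' (fun S _ => modelWt_nonneg X hb₀ hc hγ hα y S) ⟨∅, Finset.mem_univ _, ?_⟩
  have := rss_nonneg X ∅ y
  have h : priorWt p R a c (∅ : Finset (Fin p)) = 1 := by simp [priorWt]
  unfold modelWt
  rw [h]
  positivity

lemma postModel_nonneg {R : ℕ} (X : Matrix (Fin n) (Fin p) ℝ) {a₀ b₀ a c γ α : ℝ}
    (hb₀ : 0 < b₀) (hc : 0 < c) (hγ : 0 < γ) (hα : 0 < α) (y : Fin n → ℝ) (S : Finset (Fin p)) :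
    0 ≤ postModel R X a₀ b₀ a c γ α y S :=
  div_nonneg (modelWt_nonneg X hb₀ hc hγ hα y S) (sum_modelWt_pos X hb₀ hc hγ hα y).le

lemma sum_postModel {R : ℕ} (X : Matrix (Fin n) (Fin p) ℝ) {a₀ b₀ a c γ α : ℝ}
    (hb₀ : 0 < b₀) (hc : 0 < c) (hγ : 0 < γ) (hα : 0 < α) (y : Fin n → ℝ) :
    ∑ S : Finset (Fin p), postModel R X a₀ b₀ a c γ α y S = 1 := by
  unfold postModel
  rw [← Finset.sum_div]
  exact div_self (sum_modelWt_pos X hb₀ hc hγ hα y).ne'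

lemma posDef_predictive_scale (Xt : Matrix (Fin d) (Fin p) ℝ) {κ : ℝ} (hκ : 0 ≤ κ)
    (S : Finset (Fin p)) :
    ((1 : Matrix (Fin d) (Fin d) ℝ) +
      κ • (XS Xt S * ((XS Xt S)ᵀ * XS Xt S)⁻¹ * (XS Xt S)ᵀ)).PosDef := by
  have h := (Matrix.posSemidef_conjTranspose_mul_self (XS Xt S)).inv.mul_mul_conjTranspose_same
    (XS Xt S)
  rw [conjTranspose_eq_transpose_of_trivial] at h
  exact Matrix.PosDef.one.add_posSemidef (h.smul hκ)

/-- Scalar factor of the conditional predictive scale matrix. -/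
def scaleFactor (X : Matrix (Fin n) (Fin p) ℝ) (a₀ b₀ α : ℝ) (y : Fin n → ℝ)
    (S : Finset (Fin p)) : ℝ :=
  (b₀ + α / 2 * rss X S y) / (a₀ + α * n / 2)

lemma scaleFactor_pos (X : Matrix (Fin n) (Fin p) ℝ) {a₀ b₀ α : ℝ} (ha₀ : 0 < a₀) (hb₀ : 0 < b₀)
    (hα : 0 < α) (y : Fin n → ℝ) (S : Finset (Fin p)) : 0 < scaleFactor X a₀ b₀ α y S := by
  have := rss_nonneg X S y
  unfold scaleFactor
  positivity

/-- The component distribution `f^n_X̃(·|S)` of the posterior predictive mixture. -/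
def predComponent (X : Matrix (Fin n) (Fin p) ℝ) (Xt : Matrix (Fin d) (Fin p) ℝ)
    (a₀ b₀ γ α : ℝ) (y : Fin n → ℝ) (S : Finset (Fin p)) : Measure (Fin d → ℝ) :=
  (volume : Measure (Fin d → ℝ)).withDensity fun yt =>
    ENNReal.ofReal (tDensity d (2 * a₀ + α * n)
      ((XS Xt S).mulVec (betaHat X S y)) (predScale X Xt a₀ b₀ γ α y S) yt)

lemma predComponent_univ (X : Matrix (Fin n) (Fin p) ℝ) (Xt : Matrix (Fin d) (Fin p) ℝ)
    {a₀ b₀ γ α : ℝ} (ha₀ : 0 < a₀) (hb₀ : 0 < b₀) (hγ : 0 < γ) (hα : 0 < α) (y : Fin n → ℝ)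
    (S : Finset (Fin p)) : predComponent X Xt a₀ b₀ γ α y S Set.univ =
      ∫⁻ u, ENNReal.ofReal (stdStudent d (2 * a₀ + α * n) 1 u) :=
  withDensity_tDensity_univ ((posDef_predictive_scale Xt (by positivity) S).smul
    (scaleFactor_pos X ha₀ hb₀ hα y S)) _ _

lemma predLimit_univ (X : Matrix (Fin n) (Fin p) ℝ) (Xt : Matrix (Fin d) (Fin p) ℝ)
    {γ α σ0sq : ℝ} (hγ : 0 < γ) (hα : 0 < α) (hσ : 0 < σ0sq) (y : Fin n → ℝ)
    (S : Finset (Fin p)) : predLimit X Xt γ α σ0sq y S Set.univ =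
      ∫⁻ u : Fin d → ℝ, ENNReal.ofReal (stdGauss d u) :=
  withDensity_gaussDensity_univ ((posDef_predictive_scale Xt (by positivity) S).smul hσ) _

lemma abs_predComponent_sub_predLimit_le (X : Matrix (Fin n) (Fin p) ℝ)
    (Xt : Matrix (Fin d) (Fin p) ℝ) {a₀ b₀ γ α σ0sq : ℝ} (ha₀ : 0 < a₀) (hb₀ : 0 < b₀)
    (hγ : 0 < γ) (hα : 0 < α) (hσ : 0 < σ0sq) (y : Fin n → ℝ) (S : Finset (Fin p)) {ε : ℝ}
    (hε : 0 ≤ ε) (hfin : predComponent X Xt a₀ b₀ γ α y S Set.univ ≠ ⊤)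
    (hdist : studentGaussDist d (2 * a₀ + α * n) (scaleFactor X a₀ b₀ α y S / σ0sq) ≤
      ENNReal.ofReal ε) {A : Set (Fin d → ℝ)} (hA : MeasurableSet A) :
    |(predComponent X Xt a₀ b₀ γ α y S).real A - (predLimit X Xt γ α σ0sq y S).real A| ≤ ε := by
  have hW := (posDef_predictive_scale Xt (by positivity : 0 ≤ (α + γ)⁻¹) S).smul hσ
  have hs : predScale X Xt a₀ b₀ γ α y S = (scaleFactor X a₀ b₀ α y S / σ0sq) •
      (σ0sq • ((1 : Matrix (Fin d) (Fin d) ℝ) +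
        (α + γ)⁻¹ • (XS Xt S * ((XS Xt S)ᵀ * XS Xt S)⁻¹ * (XS Xt S)ᵀ))) := by
    rw [smul_smul, div_mul_cancel₀ _ hσ.ne']
    rfl
  obtain ⟨hm, hd⟩ := lintegral_abs_tDensity_sub_gaussDensity hW (2 * a₀ + α * n)
    (div_pos (scaleFactor_pos X ha₀ hb₀ hα y S) hσ) ((XS Xt S).mulVec (betaHat X S y))
  rw [← hs] at hm hd
  have hT : predComponent X Xt a₀ b₀ γ α y S A ≤ predLimit X Xt γ α σ0sq y S A +
      ENNReal.ofReal ε :=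
    (withDensity_apply_le_add hm hA).trans (by rw [hd]; exact add_le_add_right hdist _)
  have hQ : predLimit X Xt γ α σ0sq y S A ≤ predComponent X Xt a₀ b₀ γ α y S A +
      ENNReal.ofReal ε := by
    refine (withDensity_apply_le_add (by simpa only [abs_sub_comm] using hm) hA).trans ?_
    simp_rw [abs_sub_comm (gaussDensity _ _ _ _)]
    rw [hd]
    exact add_le_add_right hdist _
  have fT : predComponent X Xt a₀ b₀ γ α y S A ≠ ⊤ :=
    ne_top_of_le_ne_top hfin (measure_mono (Set.subset_univ A))
  have fQ : predLimit X Xt γ α σ0sq y S A ≠ ⊤ :=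
    ne_top_of_le_ne_top (by rw [predLimit_univ X Xt hγ hα hσ]; exact lintegral_stdGauss_ne_top d)
      (measure_mono (Set.subset_univ A))
  have hT' := ENNReal.toReal_mono (ENNReal.add_ne_top.2 ⟨fQ, ENNReal.ofReal_ne_top⟩) hT
  have hQ' := ENNReal.toReal_mono (ENNReal.add_ne_top.2 ⟨fT, ENNReal.ofReal_ne_top⟩) hQ
  rw [ENNReal.toReal_add fQ ENNReal.ofReal_ne_top, ENNReal.toReal_ofReal hε] at hT'
  rw [ENNReal.toReal_add fT ENNReal.ofReal_ne_top, ENNReal.toReal_ofReal hε] at hQ'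
  change |(predComponent X Xt a₀ b₀ γ α y S A).toReal -
    (predLimit X Xt γ α σ0sq y S A).toReal| ≤ ε
  rw [abs_le]
  constructor <;> linarith

lemma tvDist_predDist_predLimit_le {R : ℕ} (X : Matrix (Fin n) (Fin p) ℝ)
    (Xt : Matrix (Fin d) (Fin p) ℝ) {a₀ b₀ a c γ α σ0sq : ℝ} (ha₀ : 0 < a₀) (hb₀ : 0 < b₀)
    (hc : 0 < c) (hγ : 0 < γ) (hα : 0 < α) (hσ : 0 < σ0sq) (y : Fin n → ℝ) (S : Finset (Fin p))
    {C ε δ : ℝ} (hC : 0 ≤ C) (hε : 0 ≤ ε) (hδ : 0 < δ)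
    (hT : ∫⁻ u, ENNReal.ofReal (stdStudent d (2 * a₀ + α * n) 1 u) ≤ ENNReal.ofReal C)
    (hG : ∫⁻ u : Fin d → ℝ, ENNReal.ofReal (stdGauss d u) ≤ ENNReal.ofReal C)
    (hdist : ∀ r, |r - 1| < δ → studentGaussDist d (2 * a₀ + α * n) r ≤ ENNReal.ofReal ε) :
    tvDist (predDist R X Xt a₀ b₀ a c γ α y) (predLimit X Xt γ α σ0sq y S) ≤
      (1 - postModel R X a₀ b₀ a c γ α y S) * C +
        (ε + C / δ * |scaleFactor X a₀ b₀ α y S / σ0sq - 1|) := by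
  have hT' : ∀ S, predComponent X Xt a₀ b₀ γ α y S Set.univ ≤ ENNReal.ofReal C := fun S => by
    rwa [predComponent_univ X Xt ha₀ hb₀ hγ hα]
  have hQ' : predLimit X Xt γ α σ0sq y S Set.univ ≤ ENNReal.ofReal C := by
    rwa [predLimit_univ X Xt hγ hα hσ]
  refine tvDist_mixture_le (T := fun S => predComponent X Xt a₀ b₀ γ α y S)
    (postModel_nonneg X hb₀ hc hγ hα y) (sum_postModel X hb₀ hc hγ hα y) hC hT' hQ' S
    fun A hA => ?_
  rcases lt_or_ge |scaleFactor X a₀ b₀ α y S / σ0sq - 1| δ with h | h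
  · have h1 := abs_predComponent_sub_predLimit_le X Xt ha₀ hb₀ hγ hα hσ y S hε
      (ne_top_of_le_ne_top ENNReal.ofReal_ne_top (hT' S)) (hdist _ h) hA
    have h2 : 0 ≤ C / δ * |scaleFactor X a₀ b₀ α y S / σ0sq - 1| := by positivity
    linarith
  · have hle : ∀ {μ : Measure (Fin d → ℝ)}, μ Set.univ ≤ ENNReal.ofReal C → μ.real A ≤ C :=
      fun h => ENNReal.toReal_le_of_le_ofReal hC ((measure_mono (Set.subset_univ A)).trans h)
    have h1 := hle (hT' S)
    have h2 := hle hQ'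
    have h3 : 0 ≤ (predComponent X Xt a₀ b₀ γ α y S).real A := measureReal_nonneg
    have h4 : 0 ≤ (predLimit X Xt γ α σ0sq y S).real A := measureReal_nonneg
    have h5 : C ≤ C / δ * |scaleFactor X a₀ b₀ α y S / σ0sq - 1| := by
      rw [div_mul_eq_mul_div, le_div_iff₀ hδ]
      gcongr
    rw [abs_le]
    constructor <;> linarith

lemma sqHellinger_predDist_predLimit_le {R : ℕ} (X : Matrix (Fin n) (Fin p) ℝ)
    (Xt : Matrix (Fin d) (Fin p) ℝ) {a₀ b₀ a c γ α σ0sq : ℝ} (ha₀ : 0 < a₀) (hb₀ : 0 < b₀)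
    (hγ : 0 < γ) (hα : 0 < α) (hσ : 0 < σ0sq) (y : Fin n → ℝ) (S : Finset (Fin p))
    (hT : ∫⁻ u, ENNReal.ofReal (stdStudent d (2 * a₀ + α * n) 1 u) ≠ ⊤) :
    sqHellinger (predDist R X Xt a₀ b₀ a c γ α y) (predLimit X Xt γ α σ0sq y S) ≤
      2 * tvDist (predDist R X Xt a₀ b₀ a c γ α y) (predLimit X Xt γ α σ0sq y S) := by
  have : IsFiniteMeasure (predLimit X Xt γ α σ0sq y S) :=
    ⟨by rw [predLimit_univ X Xt hγ hα hσ]; exact (lintegral_stdGauss_ne_top d).lt_top⟩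
  have : IsFiniteMeasure (predDist R X Xt a₀ b₀ a c γ α y) := ⟨by
    have h : predDist R X Xt a₀ b₀ a c γ α y = ∑ S : Finset (Fin p),
      ENNReal.ofReal (postModel R X a₀ b₀ a c γ α y S) • predComponent X Xt a₀ b₀ γ α y S := rfl
    rw [h, Measure.coe_finsetSum, Finset.sum_apply]
    refine ENNReal.sum_lt_top.2 fun S _ => ?_
    rw [Measure.smul_apply, predComponent_univ X Xt ha₀ hb₀ hγ hα]
    exact ENNReal.mul_lt_top ENNReal.ofReal_lt_top hT.lt_top⟩
  exact sqHellinger_le_two_mul_tvDist _ _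

end Predictive

section Projection

variable {n p : ℕ} (X : Matrix (Fin n) (Fin p) ℝ) (S : Finset (Fin p))

lemma yHat_eq (y : Fin n → ℝ) : yHat X S y = projMat X S *ᵥ y := by
  simp only [yHat, betaHat, projMat, Matrix.mulVec_mulVec, Matrix.mul_assoc]

lemma transpose_projMat : (projMat X S)ᵀ = projMat X S := by
  have h : ((gram X S)⁻¹)ᵀ = (gram X S)⁻¹ := by
    rw [Matrix.transpose_nonsing_inv, gram, Matrix.transpose_mul, Matrix.transpose_transpose]
  simp only [projMat, Matrix.transpose_mul, Matrix.transpose_transpose, h, Matrix.mul_assoc]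

variable {X S}

lemma projMat_mul_XS (h : IsUnit (gram X S).det) : projMat X S * XS X S = XS X S := by
  have : projMat X S * XS X S = XS X S * ((gram X S)⁻¹ * gram X S) := by
    simp only [projMat, gram, Matrix.mul_assoc]
  rw [this, Matrix.nonsing_inv_mul _ h, Matrix.mul_one]

lemma projMat_mul_self (h : IsUnit (gram X S).det) :
    projMat X S * projMat X S = projMat X S := by
  conv_lhs => rw [projMat.eq_def X S, ← Matrix.mul_assoc, ← Matrix.mul_assoc, ← projMat.eq_def X S,
    projMat_mul_XS h]
  rfl

lemma trace_projMat (h : IsUnit (gram X S).det) : (projMat X S).trace = S.card := by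
  rw [projMat, Matrix.mul_assoc, Matrix.trace_mul_comm, Matrix.mul_assoc]
  change ((gram X S)⁻¹ * gram X S).trace = _
  rw [Matrix.nonsing_inv_mul _ h, Matrix.trace_one, Fintype.card_coe]

lemma mulVec_eq_XS_mulVec {β : Fin p → ℝ} (hβ : ∀ j, j ∉ S → β j = 0) :
    X *ᵥ β = XS X S *ᵥ fun j => β j.1 := by
  ext i
  simp only [Matrix.mulVec, dotProduct, XS, Matrix.of_apply]
  rw [← Finset.sum_subset (Finset.subset_univ S) (fun j _ hj => by rw [hβ j hj, mul_zero])]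
  exact (Finset.sum_coe_sort S (fun j => X i j * β j)).symm

lemma dotProduct_projMat_self (h : IsUnit (gram X S).det) (e : Fin n → ℝ) :
    (projMat X S *ᵥ e) ⬝ᵥ (projMat X S *ᵥ e) = e ⬝ᵥ (projMat X S *ᵥ e) := by
  rw [Matrix.dotProduct_mulVec, ← Matrix.mulVec_transpose, transpose_projMat,
    Matrix.mulVec_mulVec, projMat_mul_self h, dotProduct_comm]

lemma rss_eq (h : IsUnit (gram X S).det) {β : Fin p → ℝ} (hβ : ∀ j, j ∉ S → β j = 0)
    (y : Fin n → ℝ) :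
    rss X S y = (y - X *ᵥ β) ⬝ᵥ (y - X *ᵥ β)
      - (y - X *ᵥ β) ⬝ᵥ (projMat X S *ᵥ (y - X *ᵥ β)) := by
  have hμ : projMat X S *ᵥ (X *ᵥ β) = X *ᵥ β := by
    rw [mulVec_eq_XS_mulVec hβ, Matrix.mulVec_mulVec, projMat_mul_XS h]
  set e := y - X *ᵥ β with he
  have hr : y - yHat X S y = e - projMat X S *ᵥ e := by
    rw [yHat_eq, he, Matrix.mulVec_sub, hμ]
    abel
  have : rss X S y = (y - yHat X S y) ⬝ᵥ (y - yHat X S y) := by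
    simp only [rss, dotProduct, Pi.sub_apply, sq]
  rw [this, hr]
  clear_value e
  rw [sub_dotProduct, dotProduct_sub, dotProduct_sub, dotProduct_projMat_self h,
    dotProduct_comm (projMat X S *ᵥ e) e]
  ring

end Projection

section GaussianMoments

lemma gaussianReal_eq_map (m : ℝ) {v : ℝ} (hv : 0 ≤ v) :
    gaussianReal m v.toNNReal = (gaussianReal 0 1).map (fun z => √v * z + m) := by
  have h : (fun z => √v * z + m) = (fun x => x + m) ∘ fun z => √v * z := rfl
  rw [h, ← Measure.map_map (by fun_prop) (by fun_prop), gaussianReal_map_const_mul,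
    gaussianReal_map_add_const]
  congr 1
  · simp
  · ext
    simp [Real.sq_sqrt hv, hv]

lemma memLp_sub_gaussianReal (m : ℝ) (v q : ℝ≥0) :
    MemLp (fun x => x - m) q (gaussianReal m v) :=
  (memLp_id_gaussianReal q).sub (memLp_const m)

lemma integral_sub_gaussianReal (m : ℝ) (v : ℝ≥0) :
    ∫ x, (x - m) ∂gaussianReal m v = 0 := by
  have : Integrable (fun x => x) (gaussianReal m v) :=
    (memLp_id_gaussianReal (μ := m) (v := v) 1).integrable le_rfl
  rw [integral_sub this (integrable_const m)]
  simp

lemma integral_sub_sq_gaussianReal (m : ℝ) (v : ℝ≥0) :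
    ∫ x, (x - m) ^ 2 ∂gaussianReal m v = v := by
  have h := variance_fun_id_gaussianReal (μ := m) (v := v)
  rwa [variance_eq_integral (by fun_prop), integral_id_gaussianReal] at h

lemma memLp_sub_sq_gaussianReal (m : ℝ) (v : ℝ≥0) :
    MemLp (fun x => (x - m) ^ 2) 2 (gaussianReal m v) := by
  have h4 := memLp_sub_gaussianReal m v 4
  have : ENNReal.HolderTriple 4 4 2 := ⟨by
    rw [← two_mul, show (4 : ℝ≥0∞) = 2 * 2 by norm_num,
      ENNReal.mul_inv (by simp) (by simp), ← mul_assoc,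
      ENNReal.mul_inv_cancel (by simp) (by simp), one_mul]⟩
  have := MemLp.mul (p := 4) (q := 4) (r := 2) h4 h4
  refine this.congr_norm (by fun_prop) (ae_of_all _ fun x => ?_)
  simp [sq]

lemma variance_sub_sq_gaussianReal (m : ℝ) {v : ℝ} (hv : 0 ≤ v) :
    Var[fun x => (x - m) ^ 2; gaussianReal m v.toNNReal]
      = v ^ 2 * Var[fun x => x ^ 2; gaussianReal 0 1] := by
  rw [gaussianReal_eq_map m hv, variance_map (by fun_prop) (by fun_prop), ← variance_const_mul]
  congr 1
  ext z
  simp [mul_pow, Real.sq_sqrt hv]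

variable {n : ℕ} (m : Fin n → ℝ) {v : ℝ}

instance (v : ℝ) : IsProbabilityMeasure (gaussVec n m v) := by
  unfold gaussVec; infer_instance

lemma memLp_coord_gaussVec (v : ℝ) (i : Fin n) :
    MemLp (fun y : Fin n → ℝ => y i - m i) 2 (gaussVec n m v) :=
  (memLp_sub_gaussianReal (m i) v.toNNReal 2).comp_measurePreserving
    (measurePreserving_eval (fun i => gaussianReal (m i) v.toNNReal) i)

lemma integrable_coord_mul_gaussVec (v : ℝ) (i j : Fin n) :
    Integrable (fun y : Fin n → ℝ => (y i - m i) * (y j - m j)) (gaussVec n m v) :=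
  (memLp_coord_gaussVec m v i).integrable_mul (memLp_coord_gaussVec m v j)

lemma integral_coord_mul_gaussVec (hv : 0 ≤ v) (i j : Fin n) :
    ∫ y, (y i - m i) * (y j - m j) ∂gaussVec n m v = if i = j then v else 0 := by
  split_ifs with h
  · subst h
    simp only [← sq]
    have := integral_comp_eval (μ := fun i => gaussianReal (m i) v.toNNReal) (i := i)
      (f := fun x => (x - m i) ^ 2) (by fun_prop)
    rw [gaussVec, this, integral_sub_sq_gaussianReal, Real.coe_toNNReal _ hv]
  · have hind : iIndepFun (fun (i : Fin n) (y : Fin n → ℝ) => y i - m i) (gaussVec n m v) :=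
      iIndepFun_pi (X := fun i x => x - m i) fun i => by fun_prop
    rw [(hind.indepFun h).integral_fun_mul_eq_mul_integral
      (memLp_coord_gaussVec m v i).1 (memLp_coord_gaussVec m v j).1]
    have := integral_comp_eval (μ := fun i => gaussianReal (m i) v.toNNReal) (i := i)
      (f := fun x => x - m i) (by fun_prop)
    rw [gaussVec, this, integral_sub_gaussianReal, zero_mul]

lemma dotProduct_mulVec_eq_sum (A : Matrix (Fin n) (Fin n) ℝ) (e : Fin n → ℝ) :
    e ⬝ᵥ (A *ᵥ e) = ∑ i, ∑ j, A i j * (e i * e j) := by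
  simp only [dotProduct, Matrix.mulVec, Finset.mul_sum]
  exact Finset.sum_congr rfl fun i _ => Finset.sum_congr rfl fun j _ => by ring

lemma integrable_quadratic_gaussVec (v : ℝ) (A : Matrix (Fin n) (Fin n) ℝ) :
    Integrable (fun y => (y - m) ⬝ᵥ (A *ᵥ (y - m))) (gaussVec n m v) := by
  simp only [dotProduct_mulVec_eq_sum, Pi.sub_apply]
  exact integrable_finsetSum _ fun i _ => integrable_finsetSum _ fun j _ =>
    (integrable_coord_mul_gaussVec m v i j).const_mul _

lemma integral_quadratic_gaussVec (hv : 0 ≤ v) (A : Matrix (Fin n) (Fin n) ℝ) :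
    ∫ y, (y - m) ⬝ᵥ (A *ᵥ (y - m)) ∂gaussVec n m v = v * A.trace := by
  simp only [dotProduct_mulVec_eq_sum, Pi.sub_apply]
  have hint : ∀ i j, Integrable (fun y => A i j * ((y i - m i) * (y j - m j))) (gaussVec n m v) :=
    fun i j => (integrable_coord_mul_gaussVec m v i j).const_mul _
  rw [integral_finsetSum _ fun i _ => integrable_finsetSum _ fun j _ => hint i j,
    Matrix.trace, Finset.mul_sum]
  refine Finset.sum_congr rfl fun i _ => ?_
  rw [integral_finsetSum _ fun j _ => hint i j]
  simp [integral_const_mul, integral_coord_mul_gaussVec m hv, mul_comm]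

lemma memLp_normSq_gaussVec (v : ℝ) :
    MemLp (fun y => (y - m) ⬝ᵥ (y - m)) 2 (gaussVec n m v) := by
  simp only [dotProduct, Pi.sub_apply, ← sq]
  exact memLp_finsetSum _ fun i _ =>
    (memLp_sub_sq_gaussianReal (m i) v.toNNReal).comp_measurePreserving
      (measurePreserving_eval (fun i => gaussianReal (m i) v.toNNReal) i)

lemma integral_normSq_sub_sq_gaussVec (hv : 0 ≤ v) :
    ∫ y, ((y - m) ⬝ᵥ (y - m) - n * v) ^ 2 ∂gaussVec n m v
      = n * v ^ 2 * Var[fun x => x ^ 2; gaussianReal 0 1] := by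
  have hmean : ∫ y, (y - m) ⬝ᵥ (y - m) ∂gaussVec n m v = n * v := by
    have := integral_quadratic_gaussVec m hv 1
    simpa [mul_comm] using this
  have hvar := variance_sum_pi (μ := fun i => gaussianReal (m i) v.toNNReal)
    (X := fun i x => (x - m i) ^ 2) fun i => memLp_sub_sq_gaussianReal (m i) v.toNNReal
  have hsum : (∑ i, fun y : Fin n → ℝ => (y i - m i) ^ 2) = fun y => (y - m) ⬝ᵥ (y - m) := by
    ext y
    simp [dotProduct, sq]
  simp only [hsum, variance_sub_sq_gaussianReal _ hv] at hvar
  rw [← hmean, ← variance_eq_integral (memLp_normSq_gaussVec m v).aemeasurable, gaussVec, hvar]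
  simp
  ring

end GaussianMoments

section ScaleConsistency

lemma abs_le_sq_div_add {x t : ℝ} (ht : 0 < t) : |x| ≤ (x ^ 2 / t + t) / 2 := by
  have h : 0 ≤ (|x| - t) ^ 2 / t := by positivity
  have h2 : (|x| - t) ^ 2 / t = x ^ 2 / t + t - 2 * |x| := by
    rw [sub_sq, sq_abs]
    field_simp
    ring
  linarith

lemma exists_integrable_scaleFactor_bound {n p : ℕ} (hn : 0 < n) {X : Matrix (Fin n) (Fin p) ℝ}
    {S : Finset (Fin p)} (hS : IsUnit (gram X S).det) {β : Fin p → ℝ}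
    (hβ : ∀ j, j ∉ S → β j = 0) {a₀ b₀ α v d₁ d₂ : ℝ} (ha₀ : 0 < a₀) (hb₀ : 0 < b₀) (hα : 0 < α)
    (hd₁ : 0 < d₁) (hv₁ : d₁ < v) (hv₂ : v < d₂) :
    ∃ G : (Fin n → ℝ) → ℝ, Integrable G (dataDist X β v) ∧
      (∀ y, |scaleFactor X a₀ b₀ α y S / v - 1| ≤ G y) ∧
      ∫ y, G y ∂dataDist X β v ≤
        (b₀ + a₀ * d₂ + α / 2 * ((√n * (d₂ ^ 2 * Var[fun x => x ^ 2; gaussianReal 0 1]) + √n) / 2)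
          + α / 2 * (d₂ * S.card)) / (α * n / 2 * d₁) := by
  have hn' : (0 : ℝ) < n := Nat.cast_pos.2 hn
  have hs : 0 < √(n : ℝ) := Real.sqrt_pos.2 hn'
  have hss : √(n : ℝ) ^ 2 = n := Real.sq_sqrt hn'.le
  have hv : 0 < v := hd₁.trans hv₁
  set K := Var[fun x => x ^ 2; gaussianReal 0 1] with hK
  have hK0 : 0 ≤ K := variance_nonneg _ _
  set Q : (Fin n → ℝ) → ℝ := fun y => (y - X *ᵥ β) ⬝ᵥ (y - X *ᵥ β) with hQ
  set P : (Fin n → ℝ) → ℝ := fun y => (y - X *ᵥ β) ⬝ᵥ (projMat X S *ᵥ (y - X *ᵥ β)) with hP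
  have hD : 0 < (a₀ + α * n / 2) * v := by positivity
  have hPint : Integrable P (dataDist X β v) := integrable_quadratic_gaussVec _ _ _
  have hQint : Integrable (fun y => (Q y - n * v) ^ 2) (dataDist X β v) :=
    ((memLp_normSq_gaussVec (X *ᵥ β) v).sub (memLp_const (n * v))).integrable_sq
  have : IsProbabilityMeasure (dataDist X β v) := by unfold dataDist; infer_instance
  have hA := ((hQint.div_const √n).add (integrable_const √n)).div_const 2
  have hB := ((integrable_const (b₀ + a₀ * v)).add (hA.const_mul (α / 2))).add
    (hPint.const_mul (α / 2))
  refine ⟨fun y => (b₀ + a₀ * v + α / 2 * (((Q y - n * v) ^ 2 / √n + √n) / 2) + α / 2 * P y) /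
    ((a₀ + α * n / 2) * v), hB.div_const _, fun y => ?_, ?_⟩
  · have hP0 : 0 ≤ P y := by
      rw [hP]
      simp only
      rw [← dotProduct_projMat_self hS]
      exact dotProduct_self_nonneg_real _
    have hr : scaleFactor X a₀ b₀ α y S / v - 1
        = (b₀ - a₀ * v + α / 2 * (Q y - n * v) - α / 2 * P y) / ((a₀ + α * n / 2) * v) := by
      rw [scaleFactor, rss_eq hS hβ y]
      change (b₀ + α / 2 * (Q y - P y)) / (a₀ + α * n / 2) / v - 1 = _
      have : a₀ + α * n / 2 ≠ 0 := by positivity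
      field_simp
      ring
    rw [hr, abs_div, abs_of_pos hD]
    refine div_le_div_of_nonneg_right ?_ hD.le
    have h1 := abs_le_sq_div_add (x := Q y - n * v) hs
    have h2 : α / 2 * |Q y - n * v| ≤ α / 2 * (((Q y - n * v) ^ 2 / √n + √n) / 2) := by gcongr
    have h3 : |α / 2 * (Q y - n * v)| = α / 2 * |Q y - n * v| := by
      rw [abs_mul, abs_of_pos (by positivity)]
    have h4 := abs_le.1 h3.le
    have h5 : 0 ≤ α / 2 * P y := by positivity
    have h6 : 0 ≤ a₀ * v := by positivity
    rw [abs_le]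
    constructor <;> linarith [h4.1, h4.2]
  · have hI : ∫ y, (b₀ + a₀ * v + α / 2 * (((Q y - n * v) ^ 2 / √n + √n) / 2) + α / 2 * P y) /
        ((a₀ + α * n / 2) * v) ∂dataDist X β v
        = (b₀ + a₀ * v + α / 2 * ((√n * (v ^ 2 * K) + √n) / 2) + α / 2 * (v * S.card)) /
          ((a₀ + α * n / 2) * v) := by
      have e1 : ∫ y, P y ∂dataDist X β v = v * S.card := by
        rw [← trace_projMat hS]
        exact integral_quadratic_gaussVec _ hv.le _
      have e2 : ∫ y, (Q y - n * v) ^ 2 ∂dataDist X β v = n * v ^ 2 * K :=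
        integral_normSq_sub_sq_gaussVec _ hv.le
      rw [integral_div]
      congr 1
      refine (integral_add ((integrable_const (b₀ + a₀ * v)).add (hA.const_mul (α / 2)))
        (hPint.const_mul (α / 2))).trans ?_
      rw [integral_const_mul, e1]
      congr 1
      refine (integral_add (integrable_const (b₀ + a₀ * v)) (hA.const_mul (α / 2))).trans ?_
      rw [integral_const_mul, integral_const]
      simp only [probReal_univ, one_smul]
      congr 2
      refine (integral_div 2 _).trans ?_
      congr 1
      refine (integral_add (hQint.div_const √n) (integrable_const √n)).trans ?_
      rw [integral_div, e2, integral_const]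
      simp only [probReal_univ, one_smul]
      congr 1
      field_simp
      rw [hss, mul_comm]
    rw [hI]
    have : 0 < d₂ := hv.trans hv₂
    gcongr
    linarith

lemma tendsto_scaleFactor_bound {s : ℕ → ℕ}
    (hs : (fun n => (s n : ℝ)) =o[atTop] fun n : ℕ => √(n : ℝ) / Real.log n)
    (A B D E : ℝ) :
    Tendsto (fun n : ℕ => (A + B * √(n : ℝ) + D * s n) / (n * E)) atTop (nhds 0) := by
  have hnn : Tendsto (fun n : ℕ => (n : ℝ)) atTop atTop := tendsto_natCast_atTop_atTop
  have h1 : Tendsto (fun n : ℕ => A / (n : ℝ)) atTop (nhds 0) := hnn.const_div_atTop A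
  have h2 : Tendsto (fun n : ℕ => √(n : ℝ) / n) atTop (nhds 0) := by
    have : Tendsto (fun n : ℕ => 1 / √(n : ℝ)) atTop (nhds 0) :=
      (Real.tendsto_sqrt_atTop.comp hnn).const_div_atTop 1
    simpa only [Real.sqrt_div_self', one_div] using this
  have hO : (fun n : ℕ => √(n : ℝ) / Real.log n) =O[atTop] fun n : ℕ => (n : ℝ) := by
    refine Asymptotics.IsBigO.of_bound 1 ?_
    filter_upwards [(Real.tendsto_log_atTop.comp hnn).eventually_ge_atTop 1,
      eventually_ge_atTop 1] with n hl hn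
    have hn1 : (1 : ℝ) ≤ n := by exact_mod_cast hn
    simp only [Function.comp_apply] at hl
    rw [Real.norm_of_nonneg (by positivity), Real.norm_of_nonneg (by positivity), one_mul]
    refine (div_le_self (by positivity) hl).trans ?_
    exact Real.sqrt_le_iff.2 ⟨by positivity, by nlinarith⟩
  have h3 : Tendsto (fun n : ℕ => (s n : ℝ) / n) atTop (nhds 0) :=
    (hs.trans_isBigO hO).tendsto_div_nhds_zero
  have h := ((h1.add (h2.const_mul B)).add (h3.const_mul D)).div_const E
  simp only [mul_zero, add_zero, zero_div] at h
  refine h.congr fun n => ?_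
  simp only [div_eq_mul_inv, mul_inv]
  ring

end ScaleConsistency

/-- Bernstein–von Mises theorem for the posterior predictive distribution (Theorem 7):
if `s* = o(√n/log n)` and `E_{β*}[π^n(S*)] → 1`, then the expected squared Hellinger
distance (and hence total variation distance) between the posterior predictive
distribution `f^n_X̃` and its Gaussian limit tends to `0`. -/
theorem bernstein_von_mises_predictive (d : ℕ)
    (p R sstar : ℕ → ℕ) (X : ∀ n, Matrix (Fin n) (Fin (p n)) ℝ)
    (Xt : ∀ n, Matrix (Fin d) (Fin (p n)) ℝ)
    (βstar : ∀ n, Fin (p n) → ℝ) (σ0sq : ℕ → ℝ) (a₀ b₀ a c γ α d₁ d₂ : ℝ)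
    (ha₀ : 0 < a₀) (hb₀ : 0 < b₀) (ha : 0 < a) (hc : 0 < c) (hγ : 0 < γ)
    (hα0 : 0 < α) (hα1 : α < 1)
    (hnp : ∀ n, n ≤ p n) (hptop : Tendsto (fun n => p n) atTop atTop)
    (hrank : ∀ n, (X n).rank = R n)
    (hinv : ∀ n (S : Finset (Fin (p n))), S.card ≤ R n → IsUnit (gram (X n) S).det)
    (hsstar : ∀ n, sstar n = (Function.support (βstar n)).ncard)
    (hsR : ∀ n, sstar n ≤ R n)
    (hd₁ : 0 < d₁) (hA1 : ∀ n, d₁ < σ0sq n ∧ σ0sq n < d₂)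
    -- `s* = o(√n / log n)`
    (hsO : (fun n => (sstar n : ℝ)) =o[atTop] fun n => Real.sqrt n / Real.log n)
    -- `E_{β*}[π^n(S*)] → 1`
    (hpostS : Tendsto (fun n =>
        ∫ y, postModel (R n) (X n) a₀ b₀ a c γ α y (suppFinset (βstar n))
          ∂(dataDist (X n) (βstar n) (σ0sq n))) atTop (nhds 1)) :
    Tendsto (fun n =>
      ∫ y, sqHellinger (predDist (R n) (X n) (Xt n) a₀ b₀ a c γ α y)
          (predLimit (X n) (Xt n) γ α (σ0sq n) y (suppFinset (βstar n)))
        ∂(dataDist (X n) (βstar n) (σ0sq n))) atTop (nhds 0) ∧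
    Tendsto (fun n =>
      ∫ y, tvDist (predDist (R n) (X n) (Xt n) a₀ b₀ a c γ α y)
          (predLimit (X n) (Xt n) γ α (σ0sq n) y (suppFinset (βstar n)))
        ∂(dataDist (X n) (βstar n) (σ0sq n))) atTop (nhds 0) := by
  have hpos : ∀ n, 0 < σ0sq n := fun n => hd₁.trans (hA1 n).1
  have hprob : ∀ n, IsProbabilityMeasure (dataDist (X n) (βstar n) (σ0sq n)) := fun n => by
    unfold dataDist; infer_instance
  have hcard : ∀ n, (suppFinset (βstar n)).card = sstar n := fun n => by
    rw [hsstar, ← Set.ncard_coe_finset]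
    congr 1
    ext j
    simp [suppFinset]
  have hgram : ∀ n, IsUnit (gram (X n) (suppFinset (βstar n))).det := fun n =>
    hinv n _ ((hcard n).trans_le (hsR n))
  have hsupp : ∀ n j, j ∉ suppFinset (βstar n) → βstar n j = 0 := fun n j hj => by
    simpa [suppFinset] using hj
  have hdf : Tendsto (fun n : ℕ => 2 * a₀ + α * n) atTop atTop :=
    tendsto_atTop_add_const_left _ _ (tendsto_natCast_atTop_atTop.const_mul_atTop hα0)
  obtain ⟨C, hC, hCG⟩ : ∃ C : ℝ, 0 < C ∧
      (∫⁻ u : Fin d → ℝ, ENNReal.ofReal (stdGauss d u)) + 1 = ENNReal.ofReal C := by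
    refine ⟨((∫⁻ u : Fin d → ℝ, ENNReal.ofReal (stdGauss d u)) + 1).toReal,
      ENNReal.toReal_pos (by simp) ?_, (ENNReal.ofReal_toReal ?_).symm⟩ <;>
    exact ENNReal.add_ne_top.2 ⟨lintegral_stdGauss_ne_top d, ENNReal.one_ne_top⟩
  have hnear : ∀ ε : ℝ, 0 < ε → ∃ δ : ℝ, 0 < δ ∧ ∀ᶠ n : ℕ in atTop, ∀ r, |r - 1| < δ →
      studentGaussDist d (2 * a₀ + α * n) r ≤ ENNReal.ofReal ε := by
    intro ε hε
    have h := (tendsto_studentGaussDist d).eventually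
      (ge_mem_nhds (ENNReal.ofReal_pos.2 hε))
    obtain ⟨pa, hpa, pb, hpb, hab⟩ := eventually_prod_iff.1 h
    obtain ⟨δ, hδ, hball⟩ := Metric.eventually_nhds_iff.1 hpb
    exact ⟨δ, hδ, (hdf.eventually hpa).mono fun n hn r hr =>
      hab hn (hball (by rwa [Real.dist_eq]))⟩
  have hdom : ∀ ε : ℝ, 0 < ε → ∀ᶠ n in atTop, ∃ H : (Fin n → ℝ) → ℝ,
      Integrable H (dataDist (X n) (βstar n) (σ0sq n)) ∧
      ∫ y, H y ∂dataDist (X n) (βstar n) (σ0sq n) < ε ∧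
      (∀ y, tvDist (predDist (R n) (X n) (Xt n) a₀ b₀ a c γ α y)
        (predLimit (X n) (Xt n) γ α (σ0sq n) y (suppFinset (βstar n))) ≤ H y) ∧
      ∀ y, sqHellinger (predDist (R n) (X n) (Xt n) a₀ b₀ a c γ α y)
        (predLimit (X n) (Xt n) γ α (σ0sq n) y (suppFinset (βstar n))) ≤ 2 * H y := by
    intro ε hε
    obtain ⟨δ, hδ, hδn⟩ := hnear (ε / 2) (by positivity)
    obtain ⟨δ₁, hδ₁, hδ₁n⟩ := hnear 1 one_pos
    set K := Var[fun x => x ^ 2; gaussianReal 0 1] with hK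
    set bd : ℕ → ℝ := fun n => (b₀ + a₀ * d₂ + α / 2 * ((√(n : ℝ) * (d₂ ^ 2 * K) + √(n : ℝ)) / 2)
      + α / 2 * (d₂ * sstar n)) / (α * n / 2 * d₁) with hbd
    have hbd0 : Tendsto bd atTop (nhds 0) := by
      refine (tendsto_scaleFactor_bound hsO (b₀ + a₀ * d₂) (α / 2 * ((d₂ ^ 2 * K + 1) / 2))
        (α / 2 * d₂) (α / 2 * d₁)).congr fun n => ?_
      simp only [hbd]
      congr 1 <;> ring
    have hlim := (((tendsto_const_nhds (x := (1 : ℝ))).sub hpostS).mul_const C).add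
      (((tendsto_const_nhds (x := ε / 2)).add (hbd0.const_mul (C / δ))))
    rw [show (1 - 1) * C + (ε / 2 + C / δ * 0) = ε / 2 by ring] at hlim
    filter_upwards [hδn, hδ₁n, eventually_gt_atTop 0,
      hlim.eventually (gt_mem_nhds (half_lt_self hε)),
      hpostS.eventually (lt_mem_nhds zero_lt_one)] with n h1 h2 hn h3 h4
    have hwint : Integrable (fun y => postModel (R n) (X n) a₀ b₀ a c γ α y (suppFinset (βstar n)))
        (dataDist (X n) (βstar n) (σ0sq n)) := by
      by_contra h
      rw [integral_undef h] at h4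
      exact lt_irrefl _ h4
    obtain ⟨G, hGint, hG, hGle⟩ := exists_integrable_scaleFactor_bound hn (hgram n) (hsupp n)
      ha₀ hb₀ hα0 hd₁ (hA1 n).1 (hA1 n).2
    rw [hcard] at hGle
    have hT : ∫⁻ u, ENNReal.ofReal (stdStudent d (2 * a₀ + α * n) 1 u) ≤ ENNReal.ofReal C := by
      rw [← hCG]
      refine (lintegral_stdStudent_le d _).trans ?_
      gcongr
      exact (h2 1 (by simpa using hδ₁)).trans_eq ENNReal.ofReal_one
    have htv : ∀ y, tvDist (predDist (R n) (X n) (Xt n) a₀ b₀ a c γ α y)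
        (predLimit (X n) (Xt n) γ α (σ0sq n) y (suppFinset (βstar n))) ≤
        (1 - postModel (R n) (X n) a₀ b₀ a c γ α y (suppFinset (βstar n))) * C +
          (ε / 2 + C / δ * G y) := fun y => by
      refine (tvDist_predDist_predLimit_le (X n) (Xt n) ha₀ hb₀ hc hγ hα0 (hpos n) y _ hC.le
        (by positivity) hδ hT (hCG ▸ le_self_add) h1).trans ?_
      gcongr
      exact hG y
    have i1 := ((integrable_const (1 : ℝ)).sub hwint).mul_const C
    have i2 := (integrable_const (ε / 2)).add (hGint.const_mul (C / δ))
    refine ⟨_, i1.add i2, ?_, htv, fun y => ?_⟩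
    · refine lt_of_le_of_lt ?_ h3
      rw [integral_add' i1 i2]
      refine add_le_add (le_of_eq ?_) ?_
      · rw [integral_mul_const]
        congr 1
        refine (integral_sub (integrable_const _) hwint).trans ?_
        simp
      · refine (integral_add (integrable_const _) (hGint.const_mul (C / δ))).trans_le ?_
        rw [integral_const_mul, integral_const]
        simp only [probReal_univ, one_smul]
        gcongr
    · exact (sqHellinger_predDist_predLimit_le (X n) (Xt n) ha₀ hb₀ hγ hα0 (hpos n) y _
        (ne_top_of_le_ne_top ENNReal.ofReal_ne_top hT)).trans
        (mul_le_mul_of_nonneg_left (htv y) zero_le_two)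
  constructor
  · refine tendsto_order.2 ⟨fun x hx => .of_forall fun n =>
      hx.trans_le (integral_nonneg fun y => sqHellinger_nonneg _ _), fun x hx => ?_⟩
    filter_upwards [hdom (x / 2) (by positivity)] with n ⟨H, hH, hlt, _, hle⟩
    refine (integral_mono_of_nonneg (ae_of_all _ fun y => sqHellinger_nonneg _ _)
      (hH.const_mul 2) (ae_of_all _ hle)).trans_lt ?_
    rw [integral_const_mul]
    linarith
  · refine tendsto_order.2 ⟨fun x hx => .of_forall fun n =>
      hx.trans_le (integral_nonneg fun y => tvDist_nonneg _ _), fun x hx => ?_⟩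
    filter_upwards [hdom x hx] with n ⟨H, hH, hlt, hle, _⟩
    exact (integral_mono_of_nonneg (ae_of_all _ fun y => tvDist_nonneg _ _) hH
      (ae_of_all _ hle)).trans_lt hlt


end EmpiricalBayes
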